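/- arXiv:2106.14141 — 4 statements merged into one kernel-verified Lean document; each statement's English description precedes it below -/
import Mathlib

section
/- The number of demicaps in (ZMod 3)^4 with a fixed anchor point a equals 101088. -/
abbrev V4 := Fin 4 → ZMod 3

def IsCap (C : Set V4) : Prop :=
  ∀ a ∈ C, ∀ b ∈ C, ∀ c ∈ C, a ≠ b → a ≠ c → b ≠ c → a + b + c ≠ 0

def IsDemicap (a : V4) (D : Finset V4) : Prop :=
  D.card = 10 ∧ IsCap (↑D : Set V4) ∧
  ∃ d d' : Fin 5 → V4,
    (∀ i, a + d i + d' i = 0) ∧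
    D = Finset.univ.image d ∪ Finset.univ.image d' ∧
    ¬ ∃ s : Finset (Fin 5), s.card = 4 ∧
      ∃ W : Submodule (ZMod 3) V4, Module.finrank (ZMod 3) W = 3 ∧
        ∀ i ∈ s, d i - a ∈ W

/-- Any relation between the five vectors with a vanishing coefficient is trivial. -/
def GoodFrame (v : Fin 5 → V4) : Prop :=
  ∀ g : Fin 5 → ZMod 3, ∑ i, g i • v i = 0 → (∃ j, g j = 0) → g = 0

lemma goodFrame_of_no_hyperplane (v : Fin 5 → V4)
    (h : ¬ ∃ s : Finset (Fin 5), s.card = 4 ∧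
      ∃ W : Submodule (ZMod 3) V4, Module.finrank (ZMod 3) W = 3 ∧ ∀ i ∈ s, v i ∈ W) :
    GoodFrame v := by
  rintro g hg ⟨j, hj⟩
  have hLI : LinearIndependent (ZMod 3) (fun i : Fin 4 => v (j.succAbove i)) := by
    by_contra hLI
    apply h
    have hlt : Submodule.span (ZMod 3) (Set.range (fun i : Fin 4 => v (j.succAbove i))) < ⊤ := by
      rw [lt_top_iff_ne_top]
      intro htop
      apply hLI
      apply linearIndependent_of_top_le_span_of_card_eq_finrank htop.ge
      simp
    obtain ⟨f, hf, hle⟩ := Submodule.exists_le_ker_of_lt_top _ hlt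
    refine ⟨Finset.univ.erase j, by simp, LinearMap.ker f, ?_, ?_⟩
    · have := Module.Dual.finrank_ker_add_one_of_ne_zero (f := f) hf
      simp at this
      simpa using this
    · intro i hi
      obtain ⟨k, rfl⟩ := Fin.exists_succAbove_eq (Finset.ne_of_mem_erase hi)
      exact hle (Submodule.subset_span ⟨k, rfl⟩)
  rw [Fintype.linearIndependent_iff] at hLI
  rw [Fin.sum_univ_succAbove _ j, hj, zero_smul, zero_add] at hg
  have h0 := hLI _ hg
  funext i
  by_cases hi : i = j
  · rw [hi, hj]; rfl
  · obtain ⟨k, rfl⟩ := Fin.exists_succAbove_eq hi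
    exact h0 k

lemma GoodFrame.no_hyperplane {v : Fin 5 → V4} (hv : GoodFrame v) :
    ¬ ∃ s : Finset (Fin 5), s.card = 4 ∧
      ∃ W : Submodule (ZMod 3) V4, Module.finrank (ZMod 3) W = 3 ∧ ∀ i ∈ s, v i ∈ W := by
  rintro ⟨s, hs, W, hW, hsW⟩
  have hLI : LinearIndependent (ZMod 3) (fun i : s => (⟨v i, hsW i i.2⟩ : W)) := by
    rw [Fintype.linearIndependent_iff]
    intro g hg i
    have hg' : ∑ i : s, g i • v i = 0 := by
      have := congrArg W.subtype hg
      simpa using this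
    have hj : ∃ j, j ∉ s := by
      by_contra hcon
      push Not at hcon
      have : s = Finset.univ := by ext x; simp [hcon x]
      rw [this] at hs
      simp at hs
    obtain ⟨j, hj⟩ := hj
    have key := hv (fun i => if h : i ∈ s then g ⟨i, h⟩ else 0) (by
      rw [← hg', ← Finset.sum_subset (Finset.subset_univ s), ← Finset.sum_coe_sort s]
      · exact Finset.sum_congr rfl fun i _ => by simp
      · intro x _ hx
        simp [hx]) ⟨j, by simp [hj]⟩
    have := congrFun key i
    simpa using this
  have := hLI.fintype_card_le_finrank
  simp [hW, hs] at this

lemma card_goodFrame : Nat.card {v : Fin 5 → V4 // GoodFrame v} = 388177920 := by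
  have hLIcard : Nat.card {b : Fin 4 → V4 // LinearIndependent (ZMod 3) b} = 24261120 := by
    rw [card_linearIndependent (by simp)]
    simp [Fin.prod_univ_succ]
  let T : {b : Fin 4 → V4 // LinearIndependent (ZMod 3) b} × (Fin 4 → (ZMod 3)ˣ) →
      {v : Fin 5 → V4 // GoodFrame v} := fun p =>
    ⟨Fin.cons (∑ i, (p.2 i : ZMod 3) • p.1.1 i) p.1.1, by
      obtain ⟨⟨b, hb⟩, c⟩ := p
      rw [Fintype.linearIndependent_iff] at hb
      rintro g hg ⟨j, hj⟩
      simp only [Fin.sum_univ_succ (n := 4), Fin.cons_zero, Fin.cons_succ] at hg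
      rw [Finset.smul_sum, ← Finset.sum_add_distrib] at hg
      have h1 := hb (fun i => g 0 * c i + g i.succ) (by
        rw [← hg]
        exact Finset.sum_congr rfl fun i _ => by rw [add_smul, mul_smul])
      have h0 : g 0 = 0 := by
        induction j using Fin.cases with
        | zero => exact hj
        | succ j =>
          have := h1 j
          rw [hj] at this
          simpa using this
      funext i
      induction i using Fin.cases with
      | zero => exact h0
      | succ i =>
        have := h1 i
        rw [h0] at this
        simpa using this⟩
  have hT : Function.Bijective T := by
    constructor
    · rintro ⟨⟨b, hb⟩, c⟩ ⟨⟨b', hb'⟩, c'⟩ h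
      have h := congrArg Subtype.val h
      simp only [T] at h
      rw [Fin.cons_inj] at h
      obtain ⟨h1, rfl⟩ := h
      rw [Fintype.linearIndependent_iff] at hb
      have := hb (fun i => (c i : ZMod 3) - c' i) (by
        simp only [sub_smul, Finset.sum_sub_distrib]
        exact sub_eq_zero.2 h1)
      have : c = c' := by
        funext i
        exact Units.ext (sub_eq_zero.1 (this i))
      rw [this]
    · rintro ⟨v, hv⟩
      have hLI : LinearIndependent (ZMod 3) (Fin.tail v) := by
        rw [Fintype.linearIndependent_iff]
        intro g hg i
        have := hv (Fin.cons 0 g) (by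
          simp only [Fin.sum_univ_succ (n := 4), Fin.cons_zero, Fin.cons_succ]
          rw [zero_smul, zero_add]
          exact hg) ⟨0, rfl⟩
        exact congrFun this i.succ
      have hspan := hLI.span_eq_top_of_card_eq_finrank (by simp)
      have hmem : v 0 ∈ Submodule.span (ZMod 3) (Set.range (Fin.tail v)) := by
        rw [hspan]; trivial
      obtain ⟨c, hc⟩ := (Submodule.mem_span_range_iff_exists_fun _).1 hmem
      have hne : ∀ i, c i ≠ 0 := by
        intro i hi
        have := hv (Fin.cons (-1) c) (by
          simp only [Fin.sum_univ_succ (n := 4), Fin.cons_zero, Fin.cons_succ]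
          rw [← hc]
          simp [Fin.tail]) ⟨i.succ, by simpa using hi⟩
        have := congrFun this 0
        simp at this
      refine ⟨⟨⟨Fin.tail v, hLI⟩, fun i => Units.mk0 (c i) (hne i)⟩, ?_⟩
      apply Subtype.ext
      simp only [T, Units.val_mk0]
      rw [hc]
      exact Fin.cons_self_tail v
  rw [← Nat.card_congr (Equiv.ofBijective T hT), Nat.card_prod, hLIcard]
  simp [Nat.totient_prime Nat.prime_three]

/-- The points on the five lines through `a`, apart from `a`. -/
def framePt (a : V4) (v : Fin 5 → V4) (p : Fin 5 × (ZMod 3)ˣ) : V4 := a + (p.2 : ZMod 3) • v p.1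

lemma GoodFrame.framePt_injective {v : Fin 5 → V4} (hv : GoodFrame v) (a : V4) :
    Function.Injective (framePt a v) := by
  rintro ⟨i, e⟩ ⟨j, f⟩ h
  simp only [framePt, add_right_inj] at h
  have h3 : ∃ l : Fin 5, l ≠ i ∧ l ≠ j := by
    clear * -
    revert i j; decide
  obtain ⟨l, hli, hlj⟩ := h3
  have key := hv (Pi.single i (e : ZMod 3) - Pi.single j (f : ZMod 3)) (by
    simp [sub_smul, Pi.single_apply, ite_smul, Finset.sum_sub_distrib, h]) ⟨l, by simp [hli, hlj]⟩
  have hij : i = j := by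
    by_contra hij
    have := congrFun key i
    simp [hij] at this
  subst hij
  have := congrFun key i
  simp [sub_eq_zero] at this
  rw [Units.ext this]

lemma zmod3_unit (e : (ZMod 3)ˣ) : e = 1 ∨ e = -1 := by
  revert e; decide

/-- The set of ten points of a frame. -/
def frameSet (a : V4) (v : Fin 5 → V4) : Finset V4 := Finset.univ.image (framePt a v)

lemma GoodFrame.isCap {v : Fin 5 → V4} (hv : GoodFrame v) (a : V4) :
    IsCap (↑(frameSet a v) : Set V4) := by
  intro p hp q hq r hr hpq hpr hqr hsum
  simp only [frameSet, Finset.coe_image, Finset.coe_univ, Set.image_univ, Set.mem_range] at hp hq hr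
  obtain ⟨⟨i, e⟩, rfl⟩ := hp
  obtain ⟨⟨j, f⟩, rfl⟩ := hq
  obtain ⟨⟨k, t⟩, rfl⟩ := hr
  have h1 : (i, e) ≠ (j, f) := fun h => hpq (by rw [h])
  have h2 : (i, e) ≠ (k, t) := fun h => hpr (by rw [h])
  have h3 : (j, f) ≠ (k, t) := fun h => hqr (by rw [h])
  have h3a : a + a + a = 0 := by
    funext x
    simp only [Pi.add_apply, Pi.zero_apply]
    generalize a x = y
    revert y; decide
  have hs : (e : ZMod 3) • v i + (f : ZMod 3) • v j + (t : ZMod 3) • v k = 0 := by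
    simp only [framePt] at hsum
    calc _ = (a + (e : ZMod 3) • v i + (a + (f : ZMod 3) • v j) + (a + (t : ZMod 3) • v k))
          - (a + a + a) := by abel
      _ = 0 := by rw [hsum, h3a, sub_zero]
  have hl : ∃ l : Fin 5, l ≠ i ∧ l ≠ j ∧ l ≠ k := by
    clear * -
    revert i j k; decide
  obtain ⟨l, hli, hlj, hlk⟩ := hl
  have key := hv (Pi.single i (e : ZMod 3) + Pi.single j (f : ZMod 3) + Pi.single k (t : ZMod 3)) (by
    simpa [add_smul, Pi.single_apply, ite_smul, Finset.sum_add_distrib] using hs)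
    ⟨l, by simp [hli, hlj, hlk]⟩
  have ki := congrFun key i
  have kj := congrFun key j
  have kk := congrFun key k
  simp only [Pi.add_apply, Pi.single_apply, Pi.zero_apply] at ki kj kk
  clear hs key hsum hpq hpr hqr
  have n1 : ∀ u : (ZMod 3)ˣ, (u : ZMod 3) ≠ 0 := fun u => u.ne_zero
  by_cases hij : i = j
  · subst hij
    by_cases hik : i = k
    · subst hik
      simp only [ne_eq, Prod.mk.injEq, true_and] at h1 h2 h3
      rcases zmod3_unit e with rfl | rfl <;> rcases zmod3_unit f with rfl | rfl <;>
        rcases zmod3_unit t with rfl | rfl <;> simp_all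
    · simp [Ne.symm hik] at kk
  · by_cases hik : i = k
    · subst hik
      simp [Ne.symm hij] at kj
    · simp [hij, hik] at ki

lemma frameSet_eq (a : V4) (v d d' : Fin 5 → V4) (hd : ∀ i, d i = a + v i)
    (hd' : ∀ i, d' i = a - v i) :
    frameSet a v = Finset.univ.image d ∪ Finset.univ.image d' := by
  ext x
  simp only [frameSet, framePt, Finset.mem_image, Finset.mem_univ, true_and, Finset.mem_union,
    Prod.exists]
  constructor
  · rintro ⟨i, e, rfl⟩
    rcases zmod3_unit e with rfl | rfl
    · left; exact ⟨i, by simp [hd]⟩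
    · right; exact ⟨i, by simp [hd', sub_eq_add_neg]⟩
  · rintro (⟨i, rfl⟩ | ⟨i, rfl⟩)
    · exact ⟨i, 1, by simp [hd]⟩
    · exact ⟨i, -1, by simp [hd', sub_eq_add_neg]⟩

lemma v4_three (a : V4) : a + a + a = 0 := by
  funext x
  simp only [Pi.add_apply, Pi.zero_apply]
  generalize a x = y
  revert y; decide

lemma isDemicap_iff (a : V4) (D : Finset V4) :
    IsDemicap a D ↔ ∃ v, GoodFrame v ∧ frameSet a v = D := by
  constructor
  · rintro ⟨-, -, d, d', hsum, rfl, hno⟩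
    refine ⟨fun i => d i - a, goodFrame_of_no_hyperplane _ hno, ?_⟩
    apply frameSet_eq
    · intro i; simp
    · intro i
      have h1 := hsum i
      have h2 := v4_three a
      calc d' i = (a + d i + d' i) - a - d i := by abel
        _ = (a + a + a) - a - d i := by rw [h1, h2]
        _ = _ := by abel
  · rintro ⟨v, hv, rfl⟩
    refine ⟨?_, hv.isCap a, fun i => a + v i, fun i => a - v i, ?_, ?_, ?_⟩
    · rw [frameSet, Finset.card_image_of_injective _ (hv.framePt_injective a)]
      simp [Nat.totient_prime Nat.prime_three]
    · intro i
      calc a + (a + v i) + (a - v i) = a + a + a := by abel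
        _ = 0 := v4_three a
    · exact frameSet_eq _ _ _ _ (fun _ => rfl) (fun _ => rfl)
    · simpa using hv.no_hyperplane

lemma GoodFrame.twist {v : Fin 5 → V4} (hv : GoodFrame v) (σ : Equiv.Perm (Fin 5))
    (e : Fin 5 → (ZMod 3)ˣ) : GoodFrame (fun i => (e i : ZMod 3) • v (σ i)) := by
  rintro g hg ⟨j, hj⟩
  have := hv (fun i => g (σ.symm i) * e (σ.symm i)) (by
    rw [← hg, ← Equiv.sum_comp σ]
    exact Finset.sum_congr rfl fun i _ => by simp [mul_smul]) ⟨σ j, by simp [hj]⟩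
  funext i
  have := congrFun this (σ i)
  simpa using this

lemma frameSet_twist_subset (a : V4) (v : Fin 5 → V4) (σ : Equiv.Perm (Fin 5))
    (e : Fin 5 → (ZMod 3)ˣ) :
    frameSet a (fun i => (e i : ZMod 3) • v (σ i)) = frameSet a v := by
  ext x
  simp only [frameSet, framePt, Finset.mem_image, Finset.mem_univ, true_and, Prod.exists]
  constructor
  · rintro ⟨i, f, rfl⟩
    exact ⟨σ i, f * e i, by simp [mul_smul]⟩
  · rintro ⟨i, f, rfl⟩
    refine ⟨σ.symm i, f * (e (σ.symm i))⁻¹, ?_⟩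
    rw [smul_smul, ← Units.val_mul]
    simp

lemma card_fiber (a : V4) {v : Fin 5 → V4} (hv : GoodFrame v) :
    Nat.card {w : Fin 5 → V4 // GoodFrame w ∧ frameSet a w = frameSet a v} = 3840 := by
  let T : Equiv.Perm (Fin 5) × (Fin 5 → (ZMod 3)ˣ) →
      {w : Fin 5 → V4 // GoodFrame w ∧ frameSet a w = frameSet a v} := fun p =>
    ⟨fun i => (p.2 i : ZMod 3) • v (p.1 i), hv.twist _ _, frameSet_twist_subset _ _ _ _⟩
  have hT : Function.Bijective T := by
    constructor
    · rintro ⟨σ, e⟩ ⟨τ, f⟩ h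
      have h := congrArg Subtype.val h
      have h' : ∀ i, (σ i, e i) = (τ i, f i) := fun i =>
        hv.framePt_injective a (congrArg (a + ·) (congrFun h i))
      simp only [Prod.mk.injEq] at h'
      rw [Prod.mk.injEq]
      exact ⟨Equiv.ext fun i => (h' i).1, funext fun i => (h' i).2⟩
    · rintro ⟨w, hw, hwv⟩
      have hex : ∀ i, ∃ p : Fin 5 × (ZMod 3)ˣ, w i = (p.2 : ZMod 3) • v p.1 := by
        intro i
        have : framePt a w (i, 1) ∈ frameSet a v := by
          rw [← hwv]
          exact Finset.mem_image_of_mem _ (Finset.mem_univ _)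
        obtain ⟨p, -, hp⟩ := Finset.mem_image.1 this
        refine ⟨p, ?_⟩
        simpa [framePt] using hp.symm
      choose p hp using hex
      have hinj : Function.Injective (fun i => (p i).1) := by
        intro i j hij
        simp only at hij
        have hi : (((p i).2⁻¹ : (ZMod 3)ˣ) : ZMod 3) • w i = v (p i).1 := by
          rw [hp i, smul_smul, ← Units.val_mul]; simp
        have hj : (((p j).2⁻¹ : (ZMod 3)ˣ) : ZMod 3) • w j = v (p j).1 := by
          rw [hp j, smul_smul, ← Units.val_mul]; simp
        have := hw.framePt_injective a (a₁ := (i, (p i).2⁻¹)) (a₂ := (j, (p j).2⁻¹))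
          (congrArg (a + ·) (hi.trans ((congrArg v hij).trans hj.symm)))
        exact congrArg Prod.fst this
      refine ⟨⟨Equiv.ofBijective _ (Finite.injective_iff_bijective.1 hinj), fun i => (p i).2⟩, ?_⟩
      apply Subtype.ext
      funext i
      simp [T, hp i]
  rw [← Nat.card_congr (Equiv.ofBijective T hT), Nat.card_prod]
  simp [Nat.totient_prime Nat.prime_three, Fintype.card_perm, Nat.factorial]

/-- There are 101088 demicaps with a given anchor point. -/
theorem card_demicaps_with_anchor (a : V4) :
    {D : Finset V4 | IsDemicap a D}.ncard = 101088 := by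
  classical
  obtain ⟨F, hmem⟩ : ∃ F : Finset (Fin 5 → V4), ∀ v, v ∈ F ↔ GoodFrame v :=
    ⟨(Set.toFinite {v | GoodFrame v}).toFinset, fun v => Set.Finite.mem_toFinset _⟩
  have hF : F.card = 388177920 := by
    refine Eq.trans ?_ card_goodFrame
    rw [Nat.card_eq_fintype_card, Fintype.card_of_subtype F hmem]
  have hset : {D : Finset V4 | IsDemicap a D} = ↑(F.image (frameSet a)) := by
    ext D
    simp [isDemicap_iff, hmem]
  rw [hset, Set.ncard_coe_finset]
  have hfib : ∀ D ∈ F.image (frameSet a), (F.filter fun w => frameSet a w = D).card = 3840 := by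
    intro D hD
    rw [Finset.mem_image] at hD
    obtain ⟨v, hv, hD⟩ := hD
    refine Eq.trans ?_ (card_fiber a ((hmem v).1 hv))
    rw [Nat.card_eq_fintype_card]
    symm
    apply Fintype.card_of_subtype
    intro w
    rw [Finset.mem_filter, hmem, hD]
  have hsum := Finset.card_eq_sum_card_image (frameSet a) F
  rw [Finset.sum_congr rfl hfib, Finset.sum_const, hF, smul_eq_mul] at hsum
  omega
end

section
/- Every maximal cap (20-point cap) in (ZMod 3)^4 contains exactly 72 demicaps. -/
namespace Cap72

/-- The bits of `zmask` are the octal numbers whose four digits all lie in `{0, 3, 6}`. -/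
def zmask : ℕ :=
  4703570875972974379512639840884539359642195489875359075496160990783754939384398452661102310268042749547819104542108404464849131770529699417793507282886389515816203927090239899873464129473680172967007908572436153396671504675107937186939187282244934372531670594470190568383023956041254545084316117928407626343336354286171932845008291385473296698218219915948092700043328670034996564140261212474698480486693075551903851030382523004740285574956051040513934010266363524737149168033869809790560265662256033960019709650390051892028694500953507469794554746362917347714265140521092234232986207981317129703349912871088540601761961208368693960954359748827049152499387815533056650877255895190959783441885955553756045584852952604391732307315550118324624469051891054146704123649512735382074268992613855904611874823443061494530693757151140018357930628792242467096964884720866451344157131188097523482464212525860460918667793038331397720213341498996998221743300884034649386495282747400026593795041151310624740645898681867957968479885276560409242808862308844388340745390522441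

/-- Kernel friendly bit test. -/
def tb (m n : ℕ) : Bool := Nat.beq (Nat.land (Nat.shiftRight m n) 1) 1

/-- The octal codes of the 81 points. -/
def pts : List ℕ :=
  [0, 1, 2].flatMap fun d => [0, 1, 2].flatMap fun c => [0, 1, 2].flatMap fun b =>
    [0, 1, 2].map fun a => a + 8 * b + 64 * c + 512 * d

/-- Is `x` in conflict with all members of `k`? -/
def confAll (km x : ℕ) (k : List ℕ) : Bool :=
  k.all fun y => !(Nat.beq x y) && tb km (x + y)

/-- Put `x` into the first clique with which it is in conflict. -/
def ins (km x : ℕ) : List (List ℕ) → List (List ℕ)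
  | [] => [[x]]
  | k :: ks => bif confAll km x k then (x :: k) :: ks else k :: ins km x ks

/-- Greedy clique cover. -/
def cover (km : ℕ) : List ℕ → List (List ℕ) → List (List ℕ)
  | [], cl => cl
  | x :: xs, cl => cover km xs (ins km x cl)

/-- The branching vertex. -/
def pick : List (List ℕ) → ℕ
  | [] => 0
  | [k] => k.getLastD 0
  | _ :: k :: ks => pick (k :: ks)

/-- Branch and bound search for 20-caps between `ch` and `ch ∪ al`; every cap found has to
satisfy the test `g`. -/
def search (g : List ℕ → Bool) : ℕ → ℕ → ℕ → List ℕ → List ℕ → Bool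
  | 0, _, _, _, _ => false
  | _ + 1, _, 0, ch, _ => g ch
  | f + 1, km, need + 1, ch, al =>
    (fun cl : List (List ℕ) =>
      bif Nat.ble cl.length need then true else
        (fun x : ℕ =>
          (search g f (Nat.lor km (Nat.shiftRight zmask x)) need (x :: ch)
            (al.filter fun y => !(Nat.beq x y) && !(tb km (x + y)))) &&
          (search g f km (need + 1) ch (al.filter fun y => !(Nat.beq x y)))) (pick cl))
      (cover km al [])

/-- The conflict mask of a list. -/
def kmask (base : List ℕ) : ℕ :=
  base.foldr (fun x m => Nat.lor m (Nat.shiftRight zmask x)) 0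

/-- The points that are not yet excluded. -/
def start (base : List ℕ) : List ℕ :=
  pts.filter fun y => base.all fun x => !(Nat.beq x y) && !(tb (kmask base) (x + y))

theorem tb_eq (m n : ℕ) : tb m n = m.testBit n := by
  have h : (m >>> n) &&& 1 = (m >>> n) % 2 := Nat.and_one_is_mod _
  have h2 : tb m n = Nat.beq ((m >>> n) &&& 1) 1 := rfl
  rw [h2, h, Nat.testBit_eq_decide_div_mod_eq, Nat.shiftRight_eq_div_pow]
  rw [Bool.eq_iff_iff]
  simp

theorem nbeq_false {x y : ℕ} (h : x ≠ y) : Nat.beq x y = false := by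
  cases hb : Nat.beq x y
  · rfl
  · exact absurd (Nat.eq_of_beq_eq_true hb) h

theorem ne_of_not_beq {x y : ℕ} (h : (!Nat.beq x y) = true) : x ≠ y := by
  rintro rfl
  rw [Nat.beq_refl] at h
  exact Bool.noConfusion h

/-- The cap property at the level of codes. -/
def CapN (E : Finset ℕ) : Prop :=
  ∀ a ∈ E, ∀ b ∈ E, ∀ c ∈ E, a ≠ b → zmask.testBit (c + (a + b)) = false

/-- `km` only holds conflicts that come from `ch`. -/
def KmOk (km : ℕ) (ch : List ℕ) : Prop :=
  ∀ s, km.testBit s = true → ∃ c ∈ ch, zmask.testBit (c + s) = true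

theorem KmOk.cons {km : ℕ} {ch : List ℕ} (h : KmOk km ch) (x : ℕ) :
    KmOk (Nat.lor km (Nat.shiftRight zmask x)) (x :: ch) := by
  intro s hs
  have hs' : (km ||| (zmask >>> x)).testBit s = true := hs
  rw [Nat.testBit_or, Nat.testBit_shiftRight, Bool.or_eq_true] at hs'
  rcases hs' with h1 | h1
  · obtain ⟨c, hc, h2⟩ := h s h1
    exact ⟨c, List.mem_cons_of_mem _ hc, h2⟩
  · exact ⟨x, List.mem_cons_self, h1⟩

theorem kmask_ok (base : List ℕ) : KmOk (kmask base) base := by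
  induction base with
  | nil => intro s hs; simp [kmask] at hs
  | cons x xs ih => exact KmOk.cons ih x

theorem KmOk.noconf {km : ℕ} {ch : List ℕ} (h : KmOk km ch) {E : Finset ℕ} (hE : CapN E)
    (hch : ∀ c ∈ ch, c ∈ E) {x y : ℕ} (hx : x ∈ E) (hy : y ∈ E) (hxy : x ≠ y) :
    tb km (x + y) = false := by
  rw [tb_eq]
  by_contra hcon
  rw [Bool.not_eq_false] at hcon
  obtain ⟨c, hc, h2⟩ := h _ hcon
  rw [hE x hx y hy c (hch c hc) hxy] at h2
  exact Bool.noConfusion h2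

theorem confAll_spec {km x : ℕ} {k : List ℕ} {E : Finset ℕ}
    (hno : ∀ x ∈ E, ∀ y ∈ E, x ≠ y → tb km (x + y) = false)
    (hk : confAll km x k = true) (hx : x ∈ E) : k.countP (· ∈ E) = 0 := by
  rw [List.countP_eq_zero]
  intro y hy hyE
  have hyE' : y ∈ E := by simpa using hyE
  unfold confAll at hk
  rw [List.all_eq_true] at hk
  have h1 := hk y hy
  rw [Bool.and_eq_true] at h1
  have hne : x ≠ y := ne_of_not_beq h1.1
  rw [hno x hx y hyE' hne] at h1
  exact Bool.noConfusion h1.2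

theorem ins_count (km x : ℕ) (E : Finset ℕ) (cl : List (List ℕ)) :
    (ins km x cl).flatten.countP (· ∈ E) =
      (if x ∈ E then 1 else 0) + cl.flatten.countP (· ∈ E) := by
  induction cl with
  | nil => simp [ins, List.countP_cons]
  | cons k ks ih =>
    unfold ins
    cases confAll km x k
    · simp only [cond_false, List.flatten_cons, List.countP_append, ih]
      omega
    · simp only [cond_true, List.flatten_cons, List.countP_append, List.countP_cons]
      simp only [decide_eq_true_eq]
      omega

theorem ins_le {km x : ℕ} {E : Finset ℕ} {cl : List (List ℕ)}
    (hno : ∀ x ∈ E, ∀ y ∈ E, x ≠ y → tb km (x + y) = false)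
    (h : ∀ k ∈ cl, k.countP (· ∈ E) ≤ 1) : ∀ k ∈ ins km x cl, k.countP (· ∈ E) ≤ 1 := by
  induction cl with
  | nil =>
    intro k hk
    simp only [ins, List.mem_singleton] at hk
    subst hk
    exact List.countP_le_length
  | cons k ks ih =>
    intro k' hk'
    unfold ins at hk'
    have ih' := ih fun k hk => h k (List.mem_cons_of_mem _ hk)
    have hk1 := h k List.mem_cons_self
    cases hc : confAll km x k
    · rw [hc, cond_false, List.mem_cons] at hk'
      rcases hk' with rfl | hk'
      · exact hk1
      · exact ih' k' hk'
    · rw [hc, cond_true, List.mem_cons] at hk'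
      rcases hk' with rfl | hk'
      · rw [List.countP_cons]
        by_cases hx : x ∈ E
        · rw [confAll_spec hno hc hx]
          simp [hx]
        · simpa [hx] using hk1
      · exact h k' (List.mem_cons_of_mem _ hk')

theorem cover_spec {km : ℕ} {E : Finset ℕ}
    (hno : ∀ x ∈ E, ∀ y ∈ E, x ≠ y → tb km (x + y) = false) (al : List ℕ) :
    ∀ cl : List (List ℕ), (∀ k ∈ cl, k.countP (· ∈ E) ≤ 1) →
      (∀ k ∈ cover km al cl, k.countP (· ∈ E) ≤ 1) ∧
      (cover km al cl).flatten.countP (· ∈ E) =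
        al.countP (· ∈ E) + cl.flatten.countP (· ∈ E) := by
  induction al with
  | nil => intro cl h; exact ⟨h, by simp [cover]⟩
  | cons x xs ih =>
    intro cl h
    obtain ⟨h1, h2⟩ := ih (ins km x cl) (ins_le hno h)
    refine ⟨h1, ?_⟩
    unfold cover
    rw [h2, ins_count, List.countP_cons]
    simp only [decide_eq_true_eq]
    omega

theorem countP_flatten_le {E : Finset ℕ} (cl : List (List ℕ))
    (h : ∀ k ∈ cl, k.countP (· ∈ E) ≤ 1) : cl.flatten.countP (· ∈ E) ≤ cl.length := by
  induction cl with
  | nil => simp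
  | cons k ks ih =>
    have := ih fun k hk => h k (List.mem_cons_of_mem _ hk)
    have := h k List.mem_cons_self
    simp only [List.flatten_cons, List.countP_append, List.length_cons]
    omega

theorem search_spec (g : List ℕ → Bool) {E : Finset ℕ} (hE : CapN E) (hcard : E.card = 20)
    (f : ℕ) : ∀ (km need : ℕ) (ch al : List ℕ), search g f km need ch al = true →
      KmOk km ch → (∀ c ∈ ch, c ∈ E) → (∀ x ∈ E, x ∈ ch ∨ x ∈ al) → ch.length + need = 20 →
      ∃ l : List ℕ, g l = true ∧ (∀ c ∈ l, c ∈ E) ∧ l.length = 20 := by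
  induction f with
  | zero => intro km need ch al h; exact absurd h (by simp [search])
  | succ f ih =>
    intro km need ch al hs hkm hch hal hlen
    cases need with
    | zero => exact ⟨ch, hs, hch, hlen⟩
    | succ need =>
      have hno : ∀ x ∈ E, ∀ y ∈ E, x ≠ y → tb km (x + y) = false :=
        fun x hx y hy hxy => hkm.noconf hE hch hx hy hxy
      obtain ⟨hc1, hc2⟩ := cover_spec hno al [] (by simp)
      have hc3 := countP_flatten_le _ hc1
      have hEle : E.card ≤ ch.length + al.countP (· ∈ E) := by
        have hsub : E ⊆ ch.toFinset ∪ (al.filter (· ∈ E)).toFinset := by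
          intro x hx
          rcases hal x hx with h | h
          · simp [h]
          · simp [h, hx]
        calc E.card ≤ _ := Finset.card_le_card hsub
          _ ≤ _ := Finset.card_union_le _ _
          _ ≤ _ := by
            rw [List.countP_eq_length_filter]
            exact Nat.add_le_add (List.toFinset_card_le _) (List.toFinset_card_le _)
      simp only [List.flatten_nil, List.countP_nil] at hc2
      simp only [search] at hs
      have hble : Nat.ble (cover km al []).length need = false := by
        rw [Bool.eq_false_iff]
        intro h
        have := Nat.le_of_ble_eq_true h
        omega
      rw [hble, cond_false, Bool.and_eq_true] at hs
      set x := pick (cover km al []) with hx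
      by_cases hxE : x ∈ E
      · refine ih _ _ _ _ hs.1 (hkm.cons x) ?_ ?_ ?_
        · intro c hc
          rcases List.mem_cons.1 hc with rfl | hc
          · exact hxE
          · exact hch c hc
        · intro y hy
          by_cases hxy : x = y
          · left; rw [hxy]; exact List.mem_cons_self
          · rcases hal y hy with h | h
            · left; exact List.mem_cons_of_mem _ h
            · right
              rw [List.mem_filter]
              refine ⟨h, ?_⟩
              rw [hno x hxE y hy hxy]
              simp [nbeq_false hxy]
        · simp only [List.length_cons]; omega
      · refine ih _ _ _ _ hs.2 hkm hch ?_ hlen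
        intro y hy
        rcases hal y hy with h | h
        · exact Or.inl h
        · right
          rw [List.mem_filter]
          refine ⟨h, ?_⟩
          have : x ≠ y := by rintro h; exact hxE (h ▸ hy)
          simp [nbeq_false this]

theorem start_spec {E : Finset ℕ} (hE : CapN E) (hpts : ∀ x ∈ E, x ∈ pts) (base : List ℕ)
    (hb : ∀ c ∈ base, c ∈ E) : ∀ x ∈ E, x ∈ base ∨ x ∈ start base := by
  intro y hy
  by_cases hyb : y ∈ base
  · exact Or.inl hyb
  · right
    unfold start
    rw [List.mem_filter, List.all_eq_true]
    refine ⟨hpts y hy, fun x hx => ?_⟩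
    have hxy : x ≠ y := by rintro rfl; exact hyb hx
    rw [(kmask_ok base).noconf hE hb (hb x hx) hy hxy]
    simp [nbeq_false hxy]

/-- The octal code of a point. -/
def enc (v : V4) : ℕ := (v 0).val + 8 * (v 1).val + 64 * (v 2).val + 512 * (v 3).val

/-- Decoding. -/
def dec (n : ℕ) : V4 :=
  ![((n % 8 : ℕ) : ZMod 3), ((n / 8 % 8 : ℕ) : ZMod 3), ((n / 64 % 8 : ℕ) : ZMod 3),
    ((n / 512 % 8 : ℕ) : ZMod 3)]

theorem enc_digits (v : V4) : enc v % 8 = (v 0).val ∧ enc v / 8 % 8 = (v 1).val ∧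
    enc v / 64 % 8 = (v 2).val ∧ enc v / 512 % 8 = (v 3).val := by
  have h0 := ZMod.val_lt (v 0)
  have h1 := ZMod.val_lt (v 1)
  have h2 := ZMod.val_lt (v 2)
  have h3 := ZMod.val_lt (v 3)
  unfold enc
  omega

theorem dec_enc (v : V4) : dec (enc v) = v := by
  obtain ⟨h0, h1, h2, h3⟩ := enc_digits v
  unfold dec
  rw [h0, h1, h2, h3]
  ext k
  fin_cases k <;> simp

theorem enc_inj : Function.Injective enc := Function.LeftInverse.injective dec_enc

theorem pts_aux : ∀ a b c d : Fin 3,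
    (a : ℕ) + 8 * (b : ℕ) + 64 * (c : ℕ) + 512 * (d : ℕ) ∈ pts := by decide +kernel

theorem enc_mem (v : V4) : enc v ∈ pts := pts_aux (v 0) (v 1) (v 2) (v 3)

theorem zmask_aux : ∀ a b c d : Fin 7,
    tb zmask ((a : ℕ) + 8 * (b : ℕ) + 64 * (c : ℕ) + 512 * (d : ℕ)) =
      ((a : ℕ) % 3 == 0 && (b : ℕ) % 3 == 0 && (c : ℕ) % 3 == 0 && (d : ℕ) % 3 == 0) := by
  decide +kernel

theorem sum3 (a b c : ZMod 3) : (a.val + (b.val + c.val)) % 3 = 0 ↔ a + b + c = 0 := by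
  revert a b c; decide

theorem zmask_enc (a b c : V4) :
    zmask.testBit (enc a + (enc b + enc c)) = true ↔ a + b + c = 0 := by
  have hl : ∀ k, (a k).val + ((b k).val + (c k).val) < 7 := by
    intro k
    have h0 := ZMod.val_lt (a k)
    have h1 := ZMod.val_lt (b k)
    have h2 := ZMod.val_lt (c k)
    omega
  have h := zmask_aux ⟨_, hl 0⟩ ⟨_, hl 1⟩ ⟨_, hl 2⟩ ⟨_, hl 3⟩
  have he : enc a + (enc b + enc c) =
      ((a 0).val + ((b 0).val + (c 0).val)) + 8 * ((a 1).val + ((b 1).val + (c 1).val)) +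
      64 * ((a 2).val + ((b 2).val + (c 2).val)) + 512 * ((a 3).val + ((b 3).val + (c 3).val)) := by
    unfold enc; ring
  rw [he, ← tb_eq, h]
  simp only [Bool.and_eq_true, beq_iff_eq, sum3]
  constructor
  · rintro ⟨⟨⟨h0, h1⟩, h2⟩, h3⟩
    ext k
    fin_cases k
    · exact h0
    · exact h1
    · exact h2
    · exact h3
  · intro h
    exact ⟨⟨⟨congrFun h 0, congrFun h 1⟩, congrFun h 2⟩, congrFun h 3⟩

theorem three_aux (a : V4) : a + a + a = 0 := by
  ext k
  have : ∀ z : ZMod 3, z + z + z = 0 := by decide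
  exact this (a k)

theorem sum_zero_eq {a b : V4} (h : a + a + b = 0) : a = b := by
  have h3 := three_aux a
  exact add_left_cancel (h3.trans h.symm)

theorem capN_image {C : Finset V4} (hC : IsCap (↑C : Set V4)) : CapN (C.image enc) := by
  intro x hx y hy z hz hxy
  obtain ⟨a, ha, rfl⟩ := Finset.mem_image.1 hx
  obtain ⟨b, hb, rfl⟩ := Finset.mem_image.1 hy
  obtain ⟨c, hc, rfl⟩ := Finset.mem_image.1 hz
  rw [Bool.eq_false_iff]
  intro h
  have h : c + a + b = 0 := (zmask_enc c a b).1 h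
  have hab : a ≠ b := fun h => hxy (congrArg enc h)
  refine hC a ha b hb c hc hab ?_ ?_ (by rw [← h]; abel)
  · rintro rfl
    exact hab (sum_zero_eq h)
  · rintro rfl
    exact hab (sum_zero_eq (a := b) (b := a) (by rw [← h]; abel)).symm

/-- Are the two coded vectors orthogonal? -/
def dot0 (f x : ℕ) : Bool :=
  Nat.beq (((f % 8) * (x % 8) + (f / 8 % 8) * (x / 8 % 8) + (f / 64 % 8) * (x / 64 % 8) +
    (f / 512 % 8) * (x / 512 % 8)) % 3) 0

theorem dot0_spec (f x : V4) : dot0 (enc f) (enc x) = true ↔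
    f 0 * x 0 + f 1 * x 1 + f 2 * x 2 + f 3 * x 3 = 0 := by
  obtain ⟨h0, h1, h2, h3⟩ := enc_digits f
  obtain ⟨k0, k1, k2, k3⟩ := enc_digits x
  unfold dot0
  rw [h0, h1, h2, h3, k0, k1, k2, k3, Nat.beq_eq, ← Nat.dvd_iff_mod_eq_zero,
    ← ZMod.natCast_eq_zero_iff]
  push_cast
  simp only [ZMod.natCast_val, ZMod.cast_id', id]

/-- The mask of all nonzero functionals that vanish at `x`. -/
def hmAux (x : ℕ) : List ℕ → ℕ
  | [] => 0
  | f :: fs => bif !(Nat.beq f 0) && dot0 f x then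
      Nat.lor (Nat.shiftLeft 1 f) (hmAux x fs) else hmAux x fs

/-- The mask of all nonzero functionals that vanish at `x`. -/
def hm (x : ℕ) : ℕ := hmAux x pts

theorem hmAux_spec (x : ℕ) (l : List ℕ) (f : ℕ) :
    (hmAux x l).testBit f = true ↔ f ∈ l ∧ f ≠ 0 ∧ dot0 f x = true := by
  induction l with
  | nil => simp [hmAux]
  | cons y ys ih =>
    unfold hmAux
    have hb : (!(Nat.beq y 0) && dot0 y x) = true ↔ y ≠ 0 ∧ dot0 y x = true := by
      rw [Bool.and_eq_true]
      constructor
      · rintro ⟨h1, h2⟩; exact ⟨ne_of_not_beq h1, h2⟩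
      · rintro ⟨h1, h2⟩; exact ⟨by simp [nbeq_false h1], h2⟩
    cases hc : (!(Nat.beq y 0) && dot0 y x)
    · rw [cond_false, ih, List.mem_cons]
      rw [hc] at hb
      constructor
      · rintro ⟨h1, h2⟩; exact ⟨Or.inr h1, h2⟩
      · rintro ⟨h1 | h1, h2⟩
        · subst h1; exact absurd (hb.2 h2) (by simp)
        · exact ⟨h1, h2⟩
    · rw [cond_true]
      rw [hc] at hb
      have : (Nat.lor (Nat.shiftLeft 1 y) (hmAux x ys)).testBit f =
        ((1 <<< y) ||| (hmAux x ys)).testBit f := rfl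
      rw [this, Nat.testBit_or, Bool.or_eq_true, ih, List.mem_cons, Nat.one_shiftLeft,
        Nat.testBit_two_pow]
      simp only [decide_eq_true_eq]
      constructor
      · rintro (h | ⟨h1, h2⟩)
        · subst h; exact ⟨Or.inl rfl, hb.1 rfl⟩
        · exact ⟨Or.inr h1, h2⟩
      · rintro ⟨h1 | h1, h2⟩
        · exact Or.inl h1.symm
        · exact Or.inr ⟨h1, h2⟩

/-- The functionals vanishing on all members of the list. -/
def andAll : List ℕ → ℕ
  | [] => 0
  | [x] => hm x
  | x :: y :: l => Nat.land (hm x) (andAll (y :: l))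

theorem andAll_spec (f : ℕ) : ∀ l : List ℕ, l ≠ [] →
    ((andAll l).testBit f = true ↔ ∀ x ∈ l, (hm x).testBit f = true)
  | [], h => absurd rfl h
  | [x], _ => by simp [andAll]
  | x :: y :: l, _ => by
    have ih := andAll_spec f (y :: l) (by simp)
    have : (andAll (x :: y :: l)).testBit f = ((hm x) &&& (andAll (y :: l))).testBit f := rfl
    rw [this, Nat.testBit_and, Bool.and_eq_true, ih, List.forall_mem_cons (l := y :: l)]

/-- No four points of the list lie in a linear hyperplane. -/
def gen (l : List ℕ) : Bool :=
  (l.sublistsLen 4).all fun J => Nat.beq (andAll J) 0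

/-- The representatives up to sign. -/
def isRep (x : ℕ) : Bool := Nat.beq (Nat.log2 x % 3) 0

/-- The test at the leaves of the search. -/
def leaf (ch : List ℕ) : Bool :=
  decide ch.Nodup && (ch.all fun x => ch.any fun y => tb zmask (x + y)) &&
  (pts.all fun a => Nat.beq a 0 || Nat.ble (ch.countP fun x => tb (kmask ch) (a + x)) 9) &&
  Nat.beq ((((ch.filter isRep).sublistsLen 5).filter gen).length) 72


/-- The number of demicaps inside `C`. -/
noncomputable def cnt (C : Finset V4) : ℕ :=
  {D : Finset V4 | (∃ a : V4, IsDemicap a D) ∧ D ⊆ C}.ncard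

/-- `J` lies in a linear hyperplane. -/
def InHyp (J : V4 → Prop) : Prop :=
  ∃ W : Submodule (ZMod 3) V4, Module.finrank (ZMod 3) W = 3 ∧ ∀ x, J x → x ∈ W

theorem inHyp_iff (J : V4 → Prop) : InHyp J ↔
    ∃ f : V4, f ≠ 0 ∧ ∀ x, J x → f 0 * x 0 + f 1 * x 1 + f 2 * x 2 + f 3 * x 3 = 0 := by
  constructor
  · rintro ⟨W, hW, hJ⟩
    have hlt : W < ⊤ := by
      rw [lt_top_iff_ne_top]
      rintro rfl
      rw [finrank_top] at hW
      simp at hW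
    obtain ⟨f, hf, hker⟩ := Submodule.exists_le_ker_of_lt_top W hlt
    have hfx : ∀ x : V4, f x = f (Pi.single 0 1) * x 0 + f (Pi.single 1 1) * x 1 +
        f (Pi.single 2 1) * x 2 + f (Pi.single 3 1) * x 3 := by
      intro x
      rw [LinearMap.pi_apply_eq_sum_univ f x, Fin.sum_univ_four]
      have hs : ∀ i : Fin 4, (fun j => if i = j then (1 : ZMod 3) else 0) = Pi.single i 1 := by
        intro i
        ext j
        by_cases h : i = j
        · subst h; simp
        · simp [h, Ne.symm h]
      simp only [hs, smul_eq_mul]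
      ring
    refine ⟨fun k => f (Pi.single k 1), ?_, ?_⟩
    · intro h0
      apply hf
      ext x
      have h := fun k => congrFun h0 k
      simp only [Pi.zero_apply] at h
      simp [h]
    · intro x hx
      rw [← hfx x]
      exact hker (hJ x hx)
  · rintro ⟨f, hf, hJ⟩
    let φ : Module.Dual (ZMod 3) V4 := ∑ k, f k • LinearMap.proj k
    have hφ : ∀ x, φ x = f 0 * x 0 + f 1 * x 1 + f 2 * x 2 + f 3 * x 3 := by
      intro x
      simp [φ, Fin.sum_univ_four]
    have hne : φ ≠ 0 := by
      intro h0
      apply hf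
      ext k
      have := hφ (Pi.single k 1)
      rw [h0] at this
      fin_cases k <;> simpa using this.symm
    refine ⟨LinearMap.ker φ, ?_, ?_⟩
    · have := Module.Dual.finrank_ker_add_one_of_ne_zero hne
      simp at this
      exact this
    · intro x hx
      rw [LinearMap.mem_ker, hφ]
      exact hJ x hx

theorem map_sublistsLen {α β : Type*} (f : α → β) : ∀ (n : ℕ) (l : List α),
    (l.map f).sublistsLen n = (l.sublistsLen n).map (List.map f)
  | 0, l => by simp
  | _ + 1, [] => by simp
  | n + 1, a :: l => by
    rw [List.map_cons, List.sublistsLen_succ_cons, List.sublistsLen_succ_cons,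
      map_sublistsLen f (n + 1) l, map_sublistsLen f n l, List.map_append, List.map_map,
      List.map_map]
    rfl

theorem gen_spec (l : List V4) : gen (l.map enc) = true ↔
    ∀ J ∈ l.sublistsLen 4, ¬ InHyp (· ∈ J) := by
  unfold gen
  rw [map_sublistsLen, List.all_map, List.all_eq_true]
  refine forall₂_congr fun J hJ => ?_
  have hlen : J.length = 4 := (List.mem_sublistsLen.1 hJ).2
  have hne : J.map enc ≠ [] := by
    intro h
    have := congrArg List.length h
    simp [hlen] at this
  rw [Function.comp_apply, Nat.beq_eq, inHyp_iff]
  constructor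
  · rintro h ⟨f, hf, hJf⟩
    have h1 : (andAll (J.map enc)).testBit (enc f) = true := by
      rw [andAll_spec _ _ hne]
      intro x hx
      obtain ⟨v, hv, rfl⟩ := List.mem_map.1 hx
      unfold hm
      rw [hmAux_spec]
      refine ⟨enc_mem f, ?_, (dot0_spec f v).2 (hJf v hv)⟩
      intro h0
      exact hf (enc_inj (h0.trans (by simp [enc])))
    rw [h] at h1
    simp at h1
  · intro h
    by_contra hne0
    obtain ⟨i, hi⟩ := Nat.exists_testBit_of_ne_zero hne0
    rw [andAll_spec _ _ hne] at hi
    have hi' : ∀ x ∈ J, i ∈ pts ∧ i ≠ 0 ∧ dot0 i (enc x) = true := by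
      intro x hx
      have := hi (enc x) (List.mem_map_of_mem hx)
      unfold hm at this
      rwa [hmAux_spec] at this
    have hpts : ∀ i ∈ pts, enc (dec i) = i := by decide +kernel
    obtain ⟨x0, hx0⟩ : ∃ x, x ∈ J := by
      cases J with
      | nil => simp at hlen
      | cons a _ => exact ⟨a, List.mem_cons_self⟩
    have hd := hpts i (hi' x0 hx0).1
    refine h ⟨dec i, ?_, ?_⟩
    · intro h0
      rw [h0] at hd
      exact (hi' x0 hx0).2.1 (by rw [← hd]; simp [enc])
    · intro x hx
      rw [← dot0_spec, hd]
      exact (hi' x hx).2.2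

theorem filter_sublist {α : Type*} [DecidableEq α] {l R : List α} (h : l.Sublist R)
    (hR : R.Nodup) : R.filter (· ∈ l) = l := by
  have h1 : (R.filter (· ∈ l)).Nodup := hR.filter _
  have h2 : l.Sublist (R.filter (· ∈ l)) := by
    have := h.filter (fun x => decide (x ∈ l))
    rwa [List.filter_eq_self.2 (by simp)] at this
  refine (h2.eq_of_length_le ?_).symm
  have h3 : (R.filter (· ∈ l)).toFinset ⊆ l.toFinset := by
    intro x hx
    simp at hx
    simp [hx.2]
  have h4 := Finset.card_le_card h3
  rw [List.toFinset_card_of_nodup h1] at h4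
  exact h4.trans (List.toFinset_card_le _)

/-- The symmetric set spanned by a list. -/
def symSet (l : List V4) : Finset V4 := l.toFinset ∪ (l.map (- ·)).toFinset

theorem mem_symSet {l : List V4} {x : V4} : x ∈ symSet l ↔ x ∈ l ∨ -x ∈ l := by
  unfold symSet
  simp only [Finset.mem_union, List.mem_toFinset, List.mem_map]
  constructor
  · rintro (h | ⟨y, hy, rfl⟩)
    · exact Or.inl h
    · right; simpa using hy
  · rintro (h | h)
    · exact Or.inl h
    · exact Or.inr ⟨-x, h, neg_neg x⟩

theorem card_symSet {l : List V4} (hl : l.Nodup) (hd : ∀ x ∈ l, -x ∉ l) :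
    (symSet l).card = 2 * l.length := by
  unfold symSet
  rw [Finset.card_union_of_disjoint, List.toFinset_card_of_nodup hl,
    List.toFinset_card_of_nodup (hl.map neg_injective), List.length_map]
  · ring
  · rw [Finset.disjoint_left]
    intro x hx hx'
    simp only [List.mem_toFinset, List.mem_map] at hx hx'
    obtain ⟨y, hy, rfl⟩ := hx'
    exact hd y hy hx

theorem demicap_of_list {C : Finset V4} (hcap : IsCap (↑C : Set V4)) {R l : List V4}
    (hR : R.Nodup) (hC : ∀ x, x ∈ C ↔ x ∈ R ∨ -x ∈ R) (hd : ∀ x ∈ R, -x ∉ R)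
    (hl : l ∈ R.sublistsLen 5) (hg : ∀ J ∈ l.sublistsLen 4, ¬ InHyp (· ∈ J)) :
    IsDemicap 0 (symSet l) ∧ symSet l ⊆ C := by
  obtain ⟨hsub, hlen⟩ := List.mem_sublistsLen.1 hl
  have hln := hR.sublist hsub
  have hsubC : symSet l ⊆ C := by
    intro x hx
    rw [hC]
    exact (mem_symSet.1 hx).imp (fun h => hsub.subset h) (fun h => hsub.subset h)
  have hdl : ∀ x ∈ l, -x ∉ l := fun x hx h => hd x (hsub.subset hx) (hsub.subset h)
  refine ⟨⟨by rw [card_symSet hln hdl, hlen], ?_, ?_⟩, hsubC⟩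
  · intro a ha b hb c hc
    exact hcap a (hsubC ha) b (hsubC hb) c (hsubC hc)
  · let d : Fin 5 → V4 := fun i => l.get (i.cast hlen.symm)
    have hdinj : Function.Injective d := by
      intro i j hij
      have := (List.nodup_iff_injective_get.1 hln) hij
      simpa using this
    have hdmem : ∀ x, x ∈ l ↔ ∃ i, d i = x := by
      intro x
      rw [List.mem_iff_get]
      constructor
      · rintro ⟨n, hn⟩; exact ⟨n.cast hlen, by simpa [d] using hn⟩
      · rintro ⟨i, hi⟩; exact ⟨i.cast hlen.symm, hi⟩
    refine ⟨d, fun i => - d i, fun i => by simp, ?_, ?_⟩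
    · ext x
      rw [mem_symSet, hdmem, hdmem]
      simp only [Finset.mem_union, Finset.mem_image, Finset.mem_univ, true_and]
      refine or_congr Iff.rfl (exists_congr fun i => ?_)
      exact eq_neg_iff_add_eq_zero.trans (by rw [neg_eq_iff_add_eq_zero])
    · rintro ⟨s, hs, W, hW, hsW⟩
      let J := l.filter (· ∈ s.image d)
      have hJ : J.length = 4 := by
        have h1 : J.toFinset = s.image d := by
          ext x
          simp only [J, List.mem_toFinset, List.mem_filter, decide_eq_true_eq]
          refine ⟨fun h => h.2, fun h => ⟨?_, h⟩⟩
          obtain ⟨i, -, rfl⟩ := Finset.mem_image.1 h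
          exact (hdmem _).2 ⟨i, rfl⟩
        rw [← List.toFinset_card_of_nodup (hln.filter _), h1,
          Finset.card_image_of_injective _ hdinj, hs]
      refine hg J (List.mem_sublistsLen.2 ⟨List.filter_sublist, hJ⟩) ⟨W, hW, ?_⟩
      intro x hx
      simp only [J, List.mem_filter, decide_eq_true_eq] at hx
      obtain ⟨i, hi, rfl⟩ := Finset.mem_image.1 hx.2
      simpa using hsW i hi

theorem list_of_demicap {C : Finset V4} {R : List V4} {D : Finset V4}
    (hR : R.Nodup) (hC : ∀ x, x ∈ C ↔ x ∈ R ∨ -x ∈ R) (hd : ∀ x ∈ R, -x ∉ R)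
    (hD : IsDemicap 0 D) (hDC : D ⊆ C) :
    ∃ l ∈ R.sublistsLen 5, (∀ J ∈ l.sublistsLen 4, ¬ InHyp (· ∈ J)) ∧ symSet l = D := by
  obtain ⟨hcard, -, d, d', hdd, hDe, hgen⟩ := hD
  have hd' : ∀ i, d' i = - d i := by
    intro i
    have := hdd i
    rw [zero_add] at this
    exact (neg_eq_of_add_eq_zero_right this).symm
  have hDmem : ∀ x, x ∈ D ↔ ∃ i, x = d i ∨ x = - d i := by
    intro x
    rw [hDe]
    simp only [Finset.mem_union, Finset.mem_image, Finset.mem_univ, true_and, hd']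
    constructor
    · rintro (⟨i, rfl⟩ | ⟨i, rfl⟩)
      · exact ⟨i, Or.inl rfl⟩
      · exact ⟨i, Or.inr rfl⟩
    · rintro ⟨i, rfl | rfl⟩
      · exact Or.inl ⟨i, rfl⟩
      · exact Or.inr ⟨i, rfl⟩
  have hneg : ∀ x, x ∈ D → -x ∈ D := by
    intro x hx
    obtain ⟨i, rfl | rfl⟩ := (hDmem x).1 hx
    · exact (hDmem _).2 ⟨i, Or.inr rfl⟩
    · exact (hDmem _).2 ⟨i, Or.inl (neg_neg _)⟩
  let l := R.filter (· ∈ D)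
  have hlmem : ∀ x, x ∈ l ↔ x ∈ R ∧ x ∈ D := by intro x; simp [l]
  have hsym : symSet l = D := by
    ext x
    rw [mem_symSet, hlmem, hlmem]
    constructor
    · rintro (h | h)
      · exact h.2
      · simpa using hneg _ h.2
    · intro h
      exact ((hC x).1 (hDC h)).imp (fun h1 => ⟨h1, h⟩) (fun h1 => ⟨h1, hneg x h⟩)
  have hln : l.Nodup := hR.filter _
  have hdl : ∀ x ∈ l, -x ∉ l := fun x hx h => hd x ((hlmem x).1 hx).1 ((hlmem _).1 h).1
  have hlen : l.length = 5 := by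
    have := card_symSet hln hdl
    rw [hsym, hcard] at this
    omega
  refine ⟨l, List.mem_sublistsLen.2 ⟨List.filter_sublist, hlen⟩, ?_, hsym⟩
  rintro J hJ ⟨W, hW, hJW⟩
  obtain ⟨hJsub, hJlen⟩ := List.mem_sublistsLen.1 hJ
  have hJn := hln.sublist hJsub
  classical
  let s : Finset (Fin 5) := Finset.univ.filter fun i => d i ∈ W
  have hch : ∀ x ∈ J.toFinset, ∃ i, x = d i ∨ x = - d i := by
    intro x hx
    exact (hDmem x).1 ((hlmem x).1 (hJsub.subset (List.mem_toFinset.1 hx))).2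
  have hcs : 4 ≤ s.card := by
    rw [← hJlen, ← List.toFinset_card_of_nodup hJn]
    choose! φ hφ using hch
    refine Finset.card_le_card_of_injOn φ ?_ ?_
    · intro x hx
      have hx' : x ∈ J.toFinset := hx
      have hxW := hJW x (List.mem_toFinset.1 hx')
      simp only [s, Finset.coe_filter, Finset.mem_univ, true_and, Set.mem_ofPred_eq]
      rcases hφ x hx' with h | h
      · rwa [← h]
      · rw [h] at hxW
        simpa using W.neg_mem hxW
    · intro x hx y hy hxy
      have hx' : x ∈ J.toFinset := hx
      have hy' : y ∈ J.toFinset := hy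
      have hxl := hJsub.subset (List.mem_toFinset.1 hx')
      have hyl := hJsub.subset (List.mem_toFinset.1 hy')
      have h1 := hφ x hx'
      have h2 := hφ y hy'
      rw [hxy] at h1
      rcases h1 with h1 | h1 <;> rcases h2 with h2 | h2
      · exact h1.trans h2.symm
      · exact absurd hyl (by rw [h2, ← h1]; exact hdl x hxl)
      · exact absurd hxl (by rw [h1, ← h2]; exact hdl y hyl)
      · exact h1.trans h2.symm
  obtain ⟨t, hts, htc⟩ := Finset.exists_subset_card_eq hcs
  refine hgen ⟨t, htc, W, hW, fun i hi => ?_⟩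
  have := hts hi
  simp only [s, Finset.mem_filter] at this
  simpa using this.2

theorem cnt_of_reps {C : Finset V4} (hcap : IsCap (↑C : Set V4)) {R : List V4}
    (hR : R.Nodup) (hC : ∀ x, x ∈ C ↔ x ∈ R ∨ -x ∈ R) (hd : ∀ x ∈ R, -x ∉ R)
    (hanch : ∀ a : V4, a ≠ 0 → (C.filter fun x => -a - x ∈ C).card ≤ 9)
    (hcount : ((R.sublistsLen 5).filter fun l => gen (l.map enc)).length = 72) :
    cnt C = 72 := by
  set T := (R.sublistsLen 5).filter fun l => gen (l.map enc) with hT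
  have hTn : T.Nodup := (List.nodup_sublistsLen 5 hR).filter _
  have hset : {D : Finset V4 | (∃ a : V4, IsDemicap a D) ∧ D ⊆ C} =
      ((T.toFinset.image symSet : Finset (Finset V4)) : Set (Finset V4)) := by
    ext D
    simp only [Set.mem_ofPred_eq, Finset.coe_image, Set.mem_image, Finset.mem_coe,
      List.mem_toFinset, hT, List.mem_filter, gen_spec]
    constructor
    · rintro ⟨⟨a, ha⟩, hDC⟩
      have ha0 : a = 0 := by
        by_contra hne
        have h9 := hanch a hne
        have hsub : D ⊆ C.filter fun x => -a - x ∈ C := by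
          obtain ⟨-, -, d, d', hdd, hDe, -⟩ := ha
          have hmem : ∀ i, d i ∈ C ∧ d' i ∈ C := by
            intro i
            refine ⟨hDC ?_, hDC ?_⟩ <;> rw [hDe] <;> simp
          intro x hx
          rw [Finset.mem_filter]
          refine ⟨hDC hx, ?_⟩
          rw [hDe] at hx
          simp only [Finset.mem_union, Finset.mem_image, Finset.mem_univ, true_and] at hx
          rcases hx with ⟨i, rfl⟩ | ⟨i, rfl⟩
          · have : -a - d i = d' i := by
              rw [← sub_eq_zero, ← neg_eq_zero, ← hdd i]; abel
            rw [this]; exact (hmem i).2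
          · have : -a - d' i = d i := by
              rw [← sub_eq_zero, ← neg_eq_zero, ← hdd i]; abel
            rw [this]; exact (hmem i).1
        have := Finset.card_le_card hsub
        rw [ha.1] at this
        omega
      subst ha0
      obtain ⟨l, h1, h2, h3⟩ := list_of_demicap hR hC hd ha hDC
      exact ⟨l, ⟨h1, h2⟩, h3⟩
    · rintro ⟨l, ⟨h1, h2⟩, rfl⟩
      obtain ⟨h3, h4⟩ := demicap_of_list hcap hR hC hd h1 h2
      exact ⟨⟨0, h3⟩, h4⟩
  unfold cnt
  rw [hset, Set.ncard_coe_finset, Finset.card_image_of_injOn, List.toFinset_card_of_nodup hTn,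
    hcount]
  intro l hl l' hl' h
  have key : ∀ l ∈ T, R.filter (· ∈ symSet l) = l := by
    intro l hl
    have hsub := (List.mem_sublistsLen.1 (List.mem_filter.1 hl).1).1
    rw [← filter_sublist hsub hR]
    refine List.filter_congr fun x hx => ?_
    rw [filter_sublist hsub hR]
    have : -x ∉ l := fun h => hd x hx (hsub.subset h)
    simp [mem_symSet, this]
  rw [← key l (by simpa using hl), ← key l' (by simpa using hl')]
  have h' : symSet l = symSet l' := h
  rw [h']

theorem kmask_complete (base : List ℕ) (c s : ℕ) (hc : c ∈ base)
    (h : zmask.testBit (c + s) = true) : (kmask base).testBit s = true := by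
  induction base with
  | nil => simp at hc
  | cons x xs ih =>
    have : (kmask (x :: xs)).testBit s = ((kmask xs) ||| (zmask >>> x)).testBit s := rfl
    rw [this, Nat.testBit_or, Nat.testBit_shiftRight, Bool.or_eq_true]
    rcases List.mem_cons.1 hc with rfl | hc
    · exact Or.inr h
    · exact Or.inl (ih hc)

theorem isRep_spec : ∀ a b c d : ZMod 3, ![a, b, c, d] ≠ (0 : V4) →
    isRep (enc (-![a, b, c, d])) = !isRep (enc ![a, b, c, d]) := by
  decide +kernel

theorem isRep_neg (v : V4) (hv : v ≠ 0) : isRep (enc (-v)) = !isRep (enc v) := by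
  have h : v = ![v 0, v 1, v 2, v 3] := by ext k; fin_cases k <;> rfl
  have := isRep_spec (v 0) (v 1) (v 2) (v 3)
  rw [← h] at this
  exact this hv

theorem leaf_spec {C : Finset V4} (hcap : IsCap (↑C : Set V4)) (hcard : C.card = 20)
    {l : List ℕ} (hl : leaf l = true) (hsub : ∀ c ∈ l, c ∈ C.image enc) (hlen : l.length = 20) :
    cnt C = 72 := by
  obtain ⟨L, hL⟩ : ∃ L : List V4, L.map enc = l := by
    refine ⟨l.map dec, ?_⟩
    rw [List.map_map]
    conv_rhs => rw [← List.map_id l]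
    refine List.map_congr_left fun c hc => ?_
    obtain ⟨v, -, rfl⟩ := Finset.mem_image.1 (hsub c hc)
    simp [dec_enc]
  subst hL
  unfold leaf at hl
  simp only [Bool.and_eq_true, decide_eq_true_eq] at hl
  obtain ⟨⟨⟨hnd, hsym⟩, hanch⟩, hcount⟩ := hl
  have hLn : L.Nodup := List.Nodup.of_map enc hnd
  have hLC : ∀ x, x ∈ C ↔ x ∈ L := by
    have h1 : L.toFinset ⊆ C := by
      intro x hx
      obtain ⟨v, hv, he⟩ := Finset.mem_image.1
        (hsub (enc x) (List.mem_map_of_mem (List.mem_toFinset.1 hx)))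
      rwa [← enc_inj he]
    have h2 : L.toFinset = C := by
      refine Finset.eq_of_subset_of_card_le h1 ?_
      rw [List.toFinset_card_of_nodup hLn, hcard]
      simpa using hlen.ge
    intro x
    rw [← h2, List.mem_toFinset]
  have hneg : ∀ x ∈ L, -x ∈ L := by
    intro x hx
    rw [List.all_eq_true] at hsym
    have := hsym (enc x) (List.mem_map_of_mem hx)
    rw [List.any_eq_true] at this
    obtain ⟨y, hy, hxy⟩ := this
    obtain ⟨v, hv, rfl⟩ := List.mem_map.1 hy
    rw [tb_eq] at hxy
    have h0 : enc (0 : V4) = 0 := by simp [enc]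
    have h : (0 : V4) + x + v = 0 := by
      rw [← zmask_enc, h0, zero_add]; exact hxy
    rw [zero_add] at h
    rw [neg_eq_of_add_eq_zero_right h]
    exact hv
  have h0L : ∀ x ∈ L, x ≠ 0 := by
    rintro x hx rfl
    have hall : ∀ y ∈ C, y = 0 := by
      intro y hy
      by_contra hy0
      have hny := (hLC _).2 (hneg y ((hLC y).1 hy))
      refine hcap 0 ((hLC 0).2 hx) y hy (-y) hny (Ne.symm hy0) ?_ ?_ (by simp)
      · intro h; exact hy0 (by simpa using h.symm)
      · intro h
        apply hy0
        have h3 := three_aux y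
        have h4 : y + y = 0 := by nth_rw 2 [h]; simp
        rw [h4, zero_add] at h3
        exact h3
    have hle : C ⊆ {0} := fun y hy => by simpa using hall y hy
    have := Finset.card_le_card hle
    simp [hcard] at this
  let R := L.filter fun v => isRep (enc v)
  have hRmem : ∀ x, x ∈ R ↔ x ∈ L ∧ isRep (enc x) = true := by intro x; simp [R]
  refine cnt_of_reps hcap (R := R) (hLn.filter _) ?_ ?_ ?_ ?_
  · intro x
    rw [hLC, hRmem, hRmem]
    constructor
    · intro hx
      rw [isRep_neg x (h0L x hx)]
      cases hr : isRep (enc x)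
      · exact Or.inr ⟨hneg x hx, rfl⟩
      · exact Or.inl ⟨hx, rfl⟩
    · rintro (h | h)
      · exact h.1
      · simpa using hneg _ h.1
  · intro x hx hx'
    rw [hRmem] at hx hx'
    rw [isRep_neg x (h0L x hx.1), hx.2] at hx'
    exact Bool.noConfusion hx'.2
  · intro a ha
    rw [List.all_eq_true] at hanch
    have h := hanch (enc a) (enc_mem a)
    have hne : enc a ≠ 0 := fun h0 => ha (enc_inj (h0.trans (by simp [enc])))
    rw [nbeq_false hne, Bool.false_or] at h
    have h9 := Nat.le_of_ble_eq_true h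
    refine le_trans ?_ h9
    rw [List.countP_map, List.countP_eq_length_filter]
    refine le_trans (Finset.card_le_card ?_) (List.toFinset_card_le _)
    intro x hx
    rw [Finset.mem_filter] at hx
    rw [List.mem_toFinset, List.mem_filter, ← hLC]
    refine ⟨hx.1, ?_⟩
    rw [Function.comp_apply, tb_eq]
    refine kmask_complete _ (enc (-a - x)) _ (List.mem_map_of_mem ((hLC _).1 hx.2)) ?_
    rw [zmask_enc]
    abel
  · have := Nat.eq_of_beq_eq_true hcount
    rw [List.filter_map, map_sublistsLen, List.filter_map, List.length_map] at this
    exact this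

theorem demicap_map (L : V4 ≃ₗ[ZMod 3] V4) (t a : V4) {D : Finset V4} (h : IsDemicap a D) :
    IsDemicap (L a + t) (D.image fun x => L x + t) := by
  have hinj : Function.Injective fun x => L x + t :=
    fun x y h => L.injective (add_right_cancel h)
  have hsum : ∀ x y z : V4, (L x + t) + (L y + t) + (L z + t) = L (x + y + z) := by
    intro x y z
    rw [map_add, map_add, ← add_zero (L x + L y + L z), ← three_aux t]
    abel
  obtain ⟨h1, h2, d, d', h3, h4, h5⟩ := h
  refine ⟨by rw [Finset.card_image_of_injective _ hinj, h1], ?_,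
    fun i => L (d i) + t, fun i => L (d' i) + t, ?_, ?_, ?_⟩
  · intro x hx y hy z hz hxy hxz hyz
    simp only [Finset.coe_image, Set.mem_image, Finset.mem_coe] at hx hy hz
    obtain ⟨x, hx, rfl⟩ := hx
    obtain ⟨y, hy, rfl⟩ := hy
    obtain ⟨z, hz, rfl⟩ := hz
    rw [hsum, Ne, LinearEquiv.map_eq_zero_iff]
    refine h2 x hx y hy z hz ?_ ?_ ?_ <;> rintro rfl
    · exact hxy rfl
    · exact hxz rfl
    · exact hyz rfl
  · intro i
    rw [hsum, h3, map_zero]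
  · rw [h4, Finset.image_union, Finset.image_image, Finset.image_image]
    rfl
  · rintro ⟨s, hs, W, hW, hsW⟩
    refine h5 ⟨s, hs, W.map (L.symm : V4 →ₗ[ZMod 3] V4), ?_, ?_⟩
    · exact (LinearEquiv.finrank_map_eq L.symm W).trans hW
    · intro i hi
      refine ⟨_, hsW i hi, ?_⟩
      simp

theorem cap_map (L : V4 ≃ₗ[ZMod 3] V4) (t : V4) {D : Finset V4} (h2 : IsCap (↑D : Set V4)) :
    IsCap (↑(D.image fun x => L x + t) : Set V4) := by
  have hsum : ∀ x y z : V4, (L x + t) + (L y + t) + (L z + t) = L (x + y + z) := by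
    intro x y z
    rw [map_add, map_add, ← add_zero (L x + L y + L z), ← three_aux t]
    abel
  intro x hx y hy z hz hxy hxz hyz
  simp only [Finset.coe_image, Set.mem_image, Finset.mem_coe] at hx hy hz
  obtain ⟨x, hx, rfl⟩ := hx
  obtain ⟨y, hy, rfl⟩ := hy
  obtain ⟨z, hz, rfl⟩ := hz
  rw [hsum, Ne, LinearEquiv.map_eq_zero_iff]
  refine h2 x hx y hy z hz ?_ ?_ ?_ <;> rintro rfl
  · exact hxy rfl
  · exact hxz rfl
  · exact hyz rfl

theorem cnt_map (L : V4 ≃ₗ[ZMod 3] V4) (t : V4) (C : Finset V4) :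
    cnt (C.image fun x => L x + t) = cnt C := by
  have hinj : Function.Injective fun x => L x + t :=
    fun x y h => L.injective (add_right_cancel h)
  unfold cnt
  rw [← Set.ncard_image_of_injective {D : Finset V4 | (∃ a : V4, IsDemicap a D) ∧ D ⊆ C}
    (Finset.image_injective hinj)]
  congr 1
  ext D
  simp only [Set.mem_ofPred_eq, Set.mem_image]
  constructor
  · rintro ⟨⟨a, ha⟩, hDC⟩
    have hid : ∀ x, L.symm (L x + t) + -L.symm t = x := by intro x; simp
    have hid' : ∀ x, L (L.symm x + -L.symm t) + t = x := by intro x; simp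
    refine ⟨D.image fun x => L.symm x + -L.symm t,
      ⟨⟨_, demicap_map L.symm (-L.symm t) a ha⟩, ?_⟩, ?_⟩
    · intro x hx
      obtain ⟨y, hy, rfl⟩ := Finset.mem_image.1 hx
      obtain ⟨z, hz, rfl⟩ := Finset.mem_image.1 (hDC hy)
      rwa [hid]
    · rw [Finset.image_image]
      conv_rhs => rw [← Finset.image_id (s := D)]
      refine Finset.image_congr fun x _ => ?_
      exact hid' x
  · rintro ⟨D, ⟨⟨a, ha⟩, hDC⟩, rfl⟩
    exact ⟨⟨_, demicap_map L t a ha⟩, Finset.image_subset_image hDC⟩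

theorem run_spec {C : Finset V4} (hcap : IsCap (↑C : Set V4)) (hcard : C.card = 20)
    (g : List ℕ → Bool) (base : List ℕ) (P : ℕ → Bool) (need f : ℕ)
    (hb : ∀ c ∈ base, dec c ∈ C) (hbe : ∀ c ∈ base, enc (dec c) = c)
    (hP : ∀ v ∈ C, P (enc v) = true) (hlen : base.length + need = 20)
    (hs : search g f (kmask base) need base ((start base).filter P) = true) :
    ∃ l : List ℕ, g l = true ∧ (∀ c ∈ l, c ∈ C.image enc) ∧ l.length = 20 := by
  have hE := capN_image hcap
  have hEc : (C.image enc).card = 20 := by rw [Finset.card_image_of_injective _ enc_inj, hcard]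
  have hbE : ∀ c ∈ base, c ∈ C.image enc := fun c hc =>
    Finset.mem_image.2 ⟨dec c, hb c hc, hbe c hc⟩
  refine search_spec g hE hEc f _ _ _ _ hs (kmask_ok base) hbE ?_ hlen
  intro x hx
  have hpts : ∀ x ∈ C.image enc, x ∈ pts := by
    intro x hx
    obtain ⟨v, -, rfl⟩ := Finset.mem_image.1 hx
    exact enc_mem v
  refine (start_spec hE hpts base hbE x hx).imp id fun h => ?_
  rw [List.mem_filter]
  refine ⟨h, ?_⟩
  obtain ⟨v, hv, rfl⟩ := Finset.mem_image.1 hx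
  exact hP v hv

/-- The starting configuration of four antipodal pairs. -/
def baseA : List ℕ := [1, 2, 8, 16, 64, 128, 512, 1024]

/-- The starting configuration of four antipodal pairs in a hyperplane and one further point. -/
def baseB (y z : ℕ) : List ℕ := [8, 16, 64, 128, 512, 1024, 1, y, z]

theorem searchA : search leaf 200 (kmask baseA) 12 baseA
    ((start baseA).filter fun _ => true) = true := by
  decide +kernel

/-- The search statement in the second case. -/
def RunB (y z : ℕ) : Prop :=
  search (fun _ => false) 200 (kmask (baseB y z)) 11 (baseB y z)
    ((start (baseB y z)).filter fun c => !(Nat.beq c 2)) = true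

instance (y z : ℕ) : Decidable (RunB y z) := by unfold RunB; infer_instance

theorem searchB1 : RunB 584 1168 := by decide +kernel
theorem searchB2 : RunB 1096 656 := by decide +kernel
theorem searchB3 : RunB 648 1104 := by decide +kernel
theorem searchB4 : RunB 592 1160 := by decide +kernel

theorem z3 : ∀ a : ZMod 3, a = 0 ∨ a = 1 ∨ a = -1 := by decide

theorem caseA {C : Finset V4} (hcap : IsCap (↑C : Set V4)) (hcard : C.card = 20)
    (h : ∀ c ∈ baseA, dec c ∈ C) : cnt C = 72 := by
  obtain ⟨l, h1, h2, h3⟩ := run_spec hcap hcard leaf baseA (fun _ => true) 12 200 h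
    (by decide +kernel) (fun _ _ => rfl) rfl searchA
  exact leaf_spec hcap hcard h1 h2 h3

theorem caseB_aux {C : Finset V4} (hcap : IsCap (↑C : Set V4)) (hcard : C.card = 20) {y z : ℕ}
    (hr : RunB y z) (h : ∀ c ∈ baseB y z, dec c ∈ C) (hy : enc (dec y) = y)
    (hz : enc (dec z) = z) : dec 2 ∈ C := by
  by_contra hn
  have hbe : ∀ c ∈ baseB y z, enc (dec c) = c := by
    have : ∀ c ∈ [8, 16, 64, 128, 512, 1024, 1], enc (dec c) = c := by decide +kernel
    intro c hc
    have hc : c ∈ [8, 16, 64, 128, 512, 1024, 1] ++ [y, z] := hc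
    rcases List.mem_append.1 hc with hc | hc
    · exact this c hc
    · rcases List.mem_pair.1 hc with rfl | rfl
      · exact hy
      · exact hz
  have hP : ∀ v ∈ C, (!(Nat.beq (enc v) 2)) = true := by
    intro v hv
    have : enc v ≠ 2 := by
      intro h2
      apply hn
      rw [← h2, dec_enc]
      exact hv
    rw [nbeq_false this]
    rfl
  have hrun := run_spec hcap hcard (fun _ => false) (baseB y z)
    (fun c => !(Nat.beq c 2)) 11 200 h hbe hP rfl hr
  obtain ⟨l, h1, h2⟩ := hrun
  exact absurd h1 (by simp)

theorem caseB {C : Finset V4} (hcap : IsCap (↑C : Set V4)) (hcard : C.card = 20)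
    (h : ∀ c ∈ [8, 16, 64, 128, 512, 1024, 1], dec c ∈ C) {a b c : ZMod 3}
    (ha : a ≠ 0) (hb : b ≠ 0) (hc : c ≠ 0) (h1 : ![0, a, b, c] ∈ C)
    (h2 : -![0, a, b, c] ∈ C) : cnt C = 72 := by
  have key : dec 2 ∈ C := by
    have main : ∀ y z : ℕ, RunB y z → dec y ∈ C → dec z ∈ C → enc (dec y) = y →
        enc (dec z) = z → dec 2 ∈ C := by
      intro y z hr h3 h4 h5 h6
      refine caseB_aux hcap hcard hr ?_ h5 h6
      simp only [baseB, List.forall_mem_cons] at h ⊢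
      simp [h, h3, h4]
    have e1 : dec 584 = ![0, 1, 1, 1] := by decide +kernel
    have e1' : dec 1168 = -![0, 1, 1, 1] := by decide +kernel
    have e2 : dec 1096 = ![0, 1, 1, -1] := by decide +kernel
    have e2' : dec 656 = -![0, 1, 1, -1] := by decide +kernel
    have e3 : dec 648 = ![0, 1, -1, 1] := by decide +kernel
    have e3' : dec 1104 = -![0, 1, -1, 1] := by decide +kernel
    have e4 : dec 592 = ![0, -1, 1, 1] := by decide +kernel
    have e4' : dec 1160 = -![0, -1, 1, 1] := by decide +kernel
    have f1 : -![0, -1, -1, -1] = (![0, 1, 1, 1] : V4) := by decide +kernel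
    have f2 : -![0, -1, -1, 1] = (![0, 1, 1, -1] : V4) := by decide +kernel
    have f3 : -![0, -1, 1, -1] = (![0, 1, -1, 1] : V4) := by decide +kernel
    have f4 : -![0, 1, -1, -1] = (![0, -1, 1, 1] : V4) := by decide +kernel
    have m1 : (![0, 1, 1, 1] : V4) ∈ C → -(![0, 1, 1, 1] : V4) ∈ C → dec 2 ∈ C := fun p q =>
      main _ _ searchB1 (e1 ▸ p) (e1' ▸ q) (by decide +kernel) (by decide +kernel)
    have m2 : (![0, 1, 1, -1] : V4) ∈ C → -(![0, 1, 1, -1] : V4) ∈ C → dec 2 ∈ C := fun p q =>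
      main _ _ searchB2 (e2 ▸ p) (e2' ▸ q) (by decide +kernel) (by decide +kernel)
    have m3 : (![0, 1, -1, 1] : V4) ∈ C → -(![0, 1, -1, 1] : V4) ∈ C → dec 2 ∈ C := fun p q =>
      main _ _ searchB3 (e3 ▸ p) (e3' ▸ q) (by decide +kernel) (by decide +kernel)
    have m4 : (![0, -1, 1, 1] : V4) ∈ C → -(![0, -1, 1, 1] : V4) ∈ C → dec 2 ∈ C := fun p q =>
      main _ _ searchB4 (e4 ▸ p) (e4' ▸ q) (by decide +kernel) (by decide +kernel)
    rcases (z3 a).resolve_left ha with rfl | rfl <;> rcases (z3 b).resolve_left hb with rfl | rfl <;>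
      rcases (z3 c).resolve_left hc with rfl | rfl
    · exact m1 h1 h2
    · exact m2 h1 h2
    · exact m3 h1 h2
    · exact m4 (f4 ▸ h2) (by rw [← f4, neg_neg]; exact h1)
    · exact m4 h1 h2
    · exact m3 (f3 ▸ h2) (by rw [← f3, neg_neg]; exact h1)
    · exact m2 (f2 ▸ h2) (by rw [← f2, neg_neg]; exact h1)
    · exact m1 (f1 ▸ h2) (by rw [← f1, neg_neg]; exact h1)
  refine caseA hcap hcard ?_
  simp only [baseA, List.forall_mem_cons] at h ⊢
  simp [h, key]

theorem cap_eq {C : Finset V4} (hcap : IsCap (↑C : Set V4)) {x y z : V4} (hx : x ∈ C)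
    (hy : y ∈ C) (hz : z ∈ C) (h : x + y + z = 0) : x = y := by
  by_contra hxy
  refine hcap x hx y hy z hz hxy ?_ ?_ h
  · rintro rfl
    exact hxy (sum_zero_eq (by rw [← h]; abel))
  · rintro rfl
    exact hxy (sum_zero_eq (a := y) (b := x) (by rw [← h]; abel)).symm

/-- The points of `C` whose negative lies in `C`. -/
def symPts (C : Finset V4) : Finset V4 := C.filter fun x => -x ∈ C

theorem mem_symPts {C : Finset V4} {x : V4} : x ∈ symPts C ↔ x ∈ C ∧ -x ∈ C := by
  simp [symPts]

set_option maxHeartbeats 4000000 in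
theorem indep3 {C : Finset V4} (hcap : IsCap (↑C : Set V4)) (h0 : (0 : V4) ∉ C) {x y z : V4}
    (hx : x ∈ symPts C) (hy : y ∈ symPts C) (hz : z ∈ symPts C)
    (hxy : x ≠ y) (hxy' : x ≠ -y) (hxz : x ≠ z) (hxz' : x ≠ -z) (hyz : y ≠ z) (hyz' : y ≠ -z)
    {a b c : ZMod 3} (h : a • x + b • y + c • z = 0) : a = 0 ∧ b = 0 ∧ c = 0 := by
  rw [mem_symPts] at hx hy hz
  have nx : x ≠ 0 := fun h => h0 (h ▸ hx.1)
  have ny : y ≠ 0 := fun h => h0 (h ▸ hy.1)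
  have nz : z ≠ 0 := fun h => h0 (h ▸ hz.1)
  have s1 : x + y + z ≠ 0 := fun h => hxy (cap_eq hcap hx.1 hy.1 hz.1 h)
  have s2 : x + y + -z ≠ 0 := fun h => hxy (cap_eq hcap hx.1 hy.1 hz.2 h)
  have s3 : x + -y + z ≠ 0 := fun h => hxy' (cap_eq hcap hx.1 hy.2 hz.1 h)
  have s4 : x + -y + -z ≠ 0 := fun h => hxy' (cap_eq hcap hx.1 hy.2 hz.2 h)
  rcases z3 a with rfl | rfl | rfl <;> rcases z3 b with rfl | rfl | rfl <;>
    rcases z3 c with rfl | rfl | rfl <;>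
    simp only [zero_smul, one_smul, neg_smul, zero_add, add_zero] at h <;>
    first
    | exact ⟨rfl, rfl, rfl⟩
    | exact absurd (by linear_combination (1 : V4) * h) nx
    | exact absurd (by linear_combination (-1 : V4) * h) nx
    | exact absurd (by linear_combination (1 : V4) * h) ny
    | exact absurd (by linear_combination (-1 : V4) * h) ny
    | exact absurd (by linear_combination (1 : V4) * h) nz
    | exact absurd (by linear_combination (-1 : V4) * h) nz
    | exact absurd (by linear_combination (1 : V4) * h) hxy
    | exact absurd (by linear_combination (-1 : V4) * h) hxy
    | exact absurd (by linear_combination (1 : V4) * h) hxy'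
    | exact absurd (by linear_combination (-1 : V4) * h) hxy'
    | exact absurd (by linear_combination (1 : V4) * h) hxz
    | exact absurd (by linear_combination (-1 : V4) * h) hxz
    | exact absurd (by linear_combination (1 : V4) * h) hxz'
    | exact absurd (by linear_combination (-1 : V4) * h) hxz'
    | exact absurd (by linear_combination (1 : V4) * h) hyz
    | exact absurd (by linear_combination (-1 : V4) * h) hyz
    | exact absurd (by linear_combination (1 : V4) * h) hyz'
    | exact absurd (by linear_combination (-1 : V4) * h) hyz'
    | exact absurd (by linear_combination (1 : V4) * h) s1
    | exact absurd (by linear_combination (-1 : V4) * h) s1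
    | exact absurd (by linear_combination (1 : V4) * h) s2
    | exact absurd (by linear_combination (-1 : V4) * h) s2
    | exact absurd (by linear_combination (1 : V4) * h) s3
    | exact absurd (by linear_combination (-1 : V4) * h) s3
    | exact absurd (by linear_combination (1 : V4) * h) s4
    | exact absurd (by linear_combination (-1 : V4) * h) s4

/-- A linear change of coordinates. -/
theorem exists_equiv {w x y z : V4}
    (h3 : ∀ a b c : ZMod 3, a • x + b • y + c • z = 0 → a = 0 ∧ b = 0 ∧ c = 0)
    (hw : ∀ a b c : ZMod 3, w ≠ a • x + b • y + c • z) :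
    ∃ L : V4 ≃ₗ[ZMod 3] V4, ∀ d a b c : ZMod 3,
      L (d • w + a • x + b • y + c • z) = ![d, a, b, c] := by
  have : Fact (Nat.Prime 3) := ⟨Nat.prime_three⟩
  have hli : LinearIndependent (ZMod 3) ![w, x, y, z] := by
    rw [Fintype.linearIndependent_iff]
    intro g hg
    simp only [Fin.sum_univ_four] at hg
    change g 0 • w + g 1 • x + g 2 • y + g 3 • z = 0 at hg
    have hg0 : g 0 = 0 := by
      rcases z3 (g 0) with h | h | h
      · exact h
      · exfalso
        apply hw (-g 1) (-g 2) (-g 3)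
        rw [h] at hg
        simp only [one_smul, neg_smul] at hg ⊢
        linear_combination (1 : V4) * hg
      · exfalso
        apply hw (g 1) (g 2) (g 3)
        rw [h] at hg
        simp only [one_smul, neg_smul] at hg ⊢
        linear_combination (-1 : V4) * hg
    rw [hg0, zero_smul, zero_add] at hg
    obtain ⟨h1, h2, h3⟩ := h3 _ _ _ hg
    intro i
    fin_cases i
    · exact hg0
    · exact h1
    · exact h2
    · exact h3
  let B := basisOfLinearIndependentOfCardEqFinrank hli (by simp)
  refine ⟨B.equivFun, fun d a b c => ?_⟩
  have hB : ∀ i, B i = ![w, x, y, z] i := by intro i; simp [B]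
  have : d • w + a • x + b • y + c • z = B.equivFun.symm ![d, a, b, c] := by
    rw [Module.Basis.equivFun_symm_apply]
    simp [Fin.sum_univ_four, hB]
  rw [this, LinearEquiv.apply_symm_apply]

theorem exists_out {C : Finset V4} (hcap : IsCap (↑C : Set V4)) (hcard : C.card = 20) {x y z : V4}
    (hx : x ∈ C) : ∃ w ∈ C, ∀ a b c : ZMod 3, w ≠ a • x + b • y + c • z := by
  by_contra! hn
  let W : Finset V4 := Finset.univ.image fun p : ZMod 3 × ZMod 3 × ZMod 3 =>
    p.1 • x + p.2.1 • y + p.2.2 • z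
  have hW : W.card ≤ 27 := by
    refine Finset.card_image_le.trans ?_
    simp [Fintype.card_prod, ZMod.card]
  have hCW : C ⊆ W := by
    intro w hw
    obtain ⟨a, b, c, h⟩ := hn w hw
    exact Finset.mem_image.2 ⟨(a, b, c), Finset.mem_univ _, h.symm⟩
  have h1 : (C.erase x).card ≤ (W \ C).card := by
    refine Finset.card_le_card_of_injOn (fun v => -x - v) ?_ ?_
    · intro v hv
      rw [Finset.mem_coe, Finset.mem_erase] at hv
      rw [Finset.mem_coe, Finset.mem_sdiff]
      constructor
      · obtain ⟨a, b, c, h⟩ := hn v hv.2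
        refine Finset.mem_image.2 ⟨(-1 - a, -b, -c), Finset.mem_univ _, ?_⟩
        simp only [h, sub_smul, neg_smul, one_smul]
        ring
      · intro h
        exact hv.1 (cap_eq hcap hv.2 hx (z := -x - v) h (by ring))
    · intro v _ v' _ h
      exact sub_right_injective h
  rw [Finset.card_erase_of_mem hx, Finset.card_sdiff_of_subset hCW] at h1
  omega

theorem exists_anchor {C : Finset V4} (hcap : IsCap (↑C : Set V4)) (hcard : C.card = 20) :
    ∃ t : V4, t ∉ C ∧ 7 ≤ (C.filter fun x => -t - x ∈ C).card := by
  have hmaps : ∀ p ∈ C.offDiag, -(p.1 + p.2) ∈ (Finset.univ \ C : Finset V4) := by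
    intro p hp
    rw [Finset.mem_offDiag] at hp
    simp only [Finset.mem_sdiff, Finset.mem_univ, true_and]
    intro h
    exact hp.2.2 (cap_eq hcap hp.1 hp.2.1 h (by abel))
  have hlt : (Finset.univ \ C : Finset V4).card * 6 < C.offDiag.card := by
    rw [Finset.offDiag_card, Finset.card_sdiff_of_subset (Finset.subset_univ _), hcard,
      Finset.card_univ]
    simp [ZMod.card]
  obtain ⟨t, ht, h⟩ := Finset.exists_lt_card_fiber_of_mul_lt_card_of_maps_to hmaps hlt
  refine ⟨t, (Finset.mem_sdiff.1 ht).2, ?_⟩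
  refine le_trans h (Finset.card_le_card_of_injOn Prod.fst ?_ ?_)
  · intro p hp
    rw [Finset.mem_coe, Finset.mem_filter, Finset.mem_offDiag] at hp
    rw [Finset.mem_coe, Finset.mem_filter]
    refine ⟨hp.1.1, ?_⟩
    have : -t - p.1 = p.2 := by rw [← hp.2]; abel
    rw [this]
    exact hp.1.2.1
  · intro p hp q hq hpq
    rw [Finset.mem_coe, Finset.mem_filter] at hp hq
    refine Prod.ext hpq ?_
    have h1 := hp.2.trans hq.2.symm
    rw [hpq] at h1
    exact add_left_cancel (neg_injective h1)

theorem finishA {C : Finset V4} (hcap : IsCap (↑C : Set V4)) (hcard : C.card = 20)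
    (h0 : (0 : V4) ∉ C) {x y z w : V4}
    (hx : x ∈ symPts C) (hy : y ∈ symPts C) (hz : z ∈ symPts C)
    (hxy : x ≠ y) (hxy' : x ≠ -y) (hxz : x ≠ z) (hxz' : x ≠ -z) (hyz : y ≠ z) (hyz' : y ≠ -z)
    (hwz : w ∈ symPts C) (hwx : x ≠ w) (hwx' : x ≠ -w)
    (hwy : y ≠ w) (hwy' : y ≠ -w) (hwz1 : z ≠ w) (hwz' : z ≠ -w) : cnt C = 72 := by
  have hi := fun a b c : ZMod 3 =>
    indep3 hcap h0 hx hy hz hxy hxy' hxz hxz' hyz hyz' (a := a) (b := b) (c := c)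
  have gen : ∀ v ∈ C, (∀ a b c : ZMod 3, v ≠ a • x + b • y + c • z) →
      ∃ C' : Finset V4, cnt C' = cnt C ∧ IsCap (↑C' : Set V4) ∧ C'.card = 20 ∧
        (∀ d a b c : ZMod 3, d • v + a • x + b • y + c • z ∈ C → ![d, a, b, c] ∈ C') := by
    intro v hv hout
    obtain ⟨L, hL⟩ := exists_equiv hi hout
    refine ⟨C.image fun x => L x + 0, cnt_map L 0 C, cap_map L 0 hcap, ?_, ?_⟩
    · rw [Finset.card_image_of_injective _ (fun x y h => L.injective (add_right_cancel h)), hcard]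
    · intro d a b c h
      rw [← hL]
      exact Finset.mem_image.2 ⟨_, h, add_zero _⟩
  have e1 : dec 1 = ![1, 0, 0, 0] := by decide +kernel
  have e2 : dec 2 = ![-1, 0, 0, 0] := by decide +kernel
  have e8 : dec 8 = ![0, 1, 0, 0] := by decide +kernel
  have e16 : dec 16 = ![0, -1, 0, 0] := by decide +kernel
  have e64 : dec 64 = ![0, 0, 1, 0] := by decide +kernel
  have e128 : dec 128 = ![0, 0, -1, 0] := by decide +kernel
  have e512 : dec 512 = ![0, 0, 0, 1] := by decide +kernel
  have e1024 : dec 1024 = ![0, 0, 0, -1] := by decide +kernel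
  have mx := mem_symPts.1 hx
  have my := mem_symPts.1 hy
  have mz := mem_symPts.1 hz
  have mw := mem_symPts.1 hwz
  by_cases hout : ∀ a b c : ZMod 3, w ≠ a • x + b • y + c • z
  · obtain ⟨C', hc, h1, h2, h3⟩ := gen w mw.1 hout
    rw [← hc]
    refine caseA h1 h2 ?_
    simp only [baseA, List.forall_mem_cons, e1, e2, e8, e16, e64, e128, e512, e1024]
    refine ⟨h3 _ _ _ _ ?_, h3 _ _ _ _ ?_, h3 _ _ _ _ ?_, h3 _ _ _ _ ?_, h3 _ _ _ _ ?_,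
      h3 _ _ _ _ ?_, h3 _ _ _ _ ?_, h3 _ _ _ _ ?_, by simp⟩ <;> simp [mx, my, mz, mw]
  · push Not at hout
    obtain ⟨a, b, c, hw⟩ := hout
    obtain ⟨v, hv, hout⟩ := exists_out hcap hcard (x := x) (y := y) (z := z) mx.1
    obtain ⟨C', hc, h1, h2, h3⟩ := gen v hv hout
    rw [← hc]
    have one_ne : (1 : ZMod 3) ≠ 0 := by decide
    refine caseB h1 h2 (a := a) (b := b) (c := c) ?_ ?_ ?_ ?_ ?_ ?_
    · simp only [List.forall_mem_cons, e1, e8, e16, e64, e128, e512, e1024]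
      refine ⟨h3 _ _ _ _ ?_, h3 _ _ _ _ ?_, h3 _ _ _ _ ?_, h3 _ _ _ _ ?_, h3 _ _ _ _ ?_,
        h3 _ _ _ _ ?_, h3 _ _ _ _ ?_, by simp⟩ <;> simp [mx, my, mz, hv]
    · rintro rfl
      refine neg_ne_zero.2 one_ne (indep3 hcap h0 hy hz hwz hyz hyz' hwy hwy' hwz1 hwz'
        (a := b) (b := c) (c := -1) ?_).2.2
      rw [hw]; simp only [zero_smul, neg_smul, one_smul]; ring
    · rintro rfl
      refine neg_ne_zero.2 one_ne (indep3 hcap h0 hx hz hwz hxz hxz' hwx hwx' hwz1 hwz'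
        (a := a) (b := c) (c := -1) ?_).2.2
      rw [hw]; simp only [zero_smul, neg_smul, one_smul]; ring
    · rintro rfl
      refine neg_ne_zero.2 one_ne (indep3 hcap h0 hx hy hwz hxy hxy' hwx hwx' hwy hwy'
        (a := a) (b := b) (c := -1) ?_).2.2
      rw [hw]; simp only [zero_smul, neg_smul, one_smul]; ring
    · apply h3
      rw [zero_smul, zero_add, ← hw]; exact mw.1
    · have : -![0, a, b, c] = ![0, -a, -b, -c] := by simp
      rw [this]
      apply h3
      have : (0 : ZMod 3) • v + -a • x + -b • y + -c • z = -w := by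
        rw [hw, zero_smul]; simp only [neg_smul]; ring
      rw [this]; exact mw.2

theorem symmetric_case {C : Finset V4} (hcap : IsCap (↑C : Set V4)) (hcard : C.card = 20)
    (h0 : (0 : V4) ∉ C) (h7 : 7 ≤ (symPts C).card) : cnt C = 72 := by
  have pick : ∀ s : Finset V4, s.card ≤ 6 → ∃ u ∈ symPts C, u ∉ s := fun s hs =>
    Finset.exists_mem_notMem_of_card_lt_card (by omega)
  obtain ⟨x, hx, -⟩ := pick ∅ (by simp)
  obtain ⟨y, hy, hy'⟩ := pick {x, -x} (Finset.card_le_two.trans (by norm_num))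
  obtain ⟨z, hz, hz'⟩ := pick {x, -x, y, -y} (Finset.card_le_four.trans (by norm_num))
  obtain ⟨w, hw, hw'⟩ := pick {x, -x, y, -y, z, -z} Finset.card_le_six
  simp only [Finset.mem_insert, Finset.mem_singleton, not_or] at hy' hz' hw'
  have sw : ∀ {u v : V4}, u ≠ -v → v ≠ -u := by
    intro u v h h'
    exact h (by rw [h', neg_neg])
  exact finishA hcap hcard h0 hx hy hz (Ne.symm hy'.1) (sw hy'.2) (Ne.symm hz'.1) (sw hz'.2.1)
    (Ne.symm hz'.2.2.1) (sw hz'.2.2.2) hw (Ne.symm hw'.1) (sw hw'.2.1) (Ne.symm hw'.2.2.1)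
    (sw hw'.2.2.2.1) (Ne.symm hw'.2.2.2.2.1) (sw hw'.2.2.2.2.2)

theorem main {C : Finset V4} (hcap : IsCap (↑C : Set V4)) (hcard : C.card = 20) :
    cnt C = 72 := by
  obtain ⟨t, ht, h7⟩ := exists_anchor hcap hcard
  have hinj : Function.Injective fun x : V4 => LinearEquiv.refl (ZMod 3) V4 x + -t :=
    fun x y h => add_right_cancel h
  rw [← cnt_map (LinearEquiv.refl (ZMod 3) V4) (-t) C]
  refine symmetric_case (cap_map _ _ hcap) ?_ ?_ ?_
  · rw [Finset.card_image_of_injective _ hinj, hcard]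
  · intro h
    obtain ⟨x, hx, h⟩ := Finset.mem_image.1 h
    apply ht
    have : x = t := by
      have h : x + -t = 0 := h
      exact add_neg_eq_zero.1 h
    rwa [← this]
  · refine le_trans h7 (Finset.card_le_card_of_injOn _ ?_ (hinj.injOn))
    intro x hx
    rw [Finset.mem_coe, Finset.mem_filter] at hx
    rw [Finset.mem_coe, mem_symPts]
    refine ⟨Finset.mem_image_of_mem _ hx.1, Finset.mem_image.2 ⟨_, hx.2, ?_⟩⟩
    change -t - x + -t = -(x + -t)
    linear_combination (-1 : V4) * three_aux t

end Cap72

/-- Every maximal (20-point) cap contains exactly 72 demicaps. -/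
theorem maxcap_contains_72_demicaps (C : Finset V4)
    (hcap : IsCap (↑C : Set V4)) (hcard : C.card = 20) :
    {D : Finset V4 | (∃ a : V4, IsDemicap a D) ∧ D ⊆ C}.ncard = 72 := by
  exact Cap72.main hcap hcard
end

section
/- If C is a maximal (20-point) cap in (ZMod 3)^4 with anchor a, and D ⊆ C is a demicap, then the complement C \ D is also a demicap. Consequently C can be written as a disjoint union of two demicaps in exactly 36 ways. -/
section Design
variable (Bl : Finset (Finset (Fin 10)))

/-- Counting three-subsets of `X` by their intersection with `D`. -/
lemma card_three_inter (X D : Finset (Fin 10)) (j : ℕ) (hj : j ≤ 3) :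
    ((X.powersetCard 3).filter (fun S => (S ∩ D).card = j)).card
      = (X ∩ D).card.choose j * (X \ D).card.choose (3 - j) := by
  rw [← Finset.card_powersetCard, ← Finset.card_powersetCard, ← Finset.card_product]
  refine Finset.card_nbij' (fun S => (S ∩ D, S \ D)) (fun q => q.1 ∪ q.2) ?_ ?_ ?_ ?_
  · intro S hS
    simp only [Finset.coe_filter, Finset.mem_powersetCard, Set.mem_ofPred_eq] at hS
    simp only [Finset.coe_product, Set.mem_prod, Finset.mem_coe, Finset.mem_powersetCard]
    have := Finset.card_inter_add_card_sdiff S D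
    refine ⟨⟨Finset.inter_subset_inter_right hS.1.1, hS.2⟩,
      Finset.sdiff_subset_sdiff hS.1.1 (Finset.Subset.refl _), by omega⟩
  · rintro ⟨P, Q⟩ h
    simp only [Finset.coe_product, Set.mem_prod, Finset.mem_coe, Finset.mem_powersetCard] at h
    simp only [Finset.coe_filter, Finset.mem_powersetCard, Set.mem_ofPred_eq]
    obtain ⟨⟨hP, hPc⟩, hQ, hQc⟩ := h
    have hd : Disjoint P Q := by
      rw [Finset.disjoint_left]
      intro x hx hx'
      have h1 := hP hx
      have h2 := hQ hx'
      simp at h1 h2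
      exact h2.2 h1.2
    have he : (P ∪ Q) ∩ D = P := by
      ext x
      have h1 := @hP x
      have h2 := @hQ x
      simp only [Finset.mem_inter, Finset.mem_sdiff, Finset.mem_union] at *
      tauto
    refine ⟨⟨?_, ?_⟩, ?_⟩
    · intro x hx
      have h1 := @hP x
      have h2 := @hQ x
      simp only [Finset.mem_inter, Finset.mem_sdiff, Finset.mem_union] at *
      tauto
    · rw [Finset.card_union_of_disjoint hd]; omega
    · rw [he, hPc]
  · intro S _
    ext x
    simp only [Finset.mem_inter, Finset.mem_sdiff, Finset.mem_union]
    tauto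
  · rintro ⟨P, Q⟩ h
    simp only [Finset.coe_product, Set.mem_prod, Finset.mem_coe, Finset.mem_powersetCard] at h
    obtain ⟨⟨hP, hPc⟩, hQ, hQc⟩ := h
    ext x <;>
    · have h1 := @hP x
      have h2 := @hQ x
      simp only [Finset.mem_inter, Finset.mem_sdiff, Finset.mem_union] at *
      tauto

/-- Each triple lies in one block, so triples with a property can be counted blockwise. -/
lemma sum_blocks
    (h3 : ∀ t : Finset (Fin 10), t.card = 3 → (Bl.filter (fun b => t ⊆ b)).card = 1)
    (P : Finset (Fin 10) → Prop) [DecidablePred P] :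
    ∑ b ∈ Bl, ((b.powersetCard 3).filter P).card
      = (((Finset.univ : Finset (Fin 10)).powersetCard 3).filter P).card := by
  have := Finset.sum_card_bipartiteAbove_eq_sum_card_bipartiteBelow (s := Bl)
    (t := ((Finset.univ : Finset (Fin 10)).powersetCard 3).filter P) (fun b t => t ⊆ b)
  rw [Finset.card_eq_sum_ones]
  calc _ = _ := ?_
    _ = _ := this
    _ = _ := ?_
  · refine Finset.sum_congr rfl fun b _ => ?_
    congr 1
    ext t
    simp only [Finset.bipartiteAbove, Finset.mem_filter, Finset.mem_powersetCard,
      Finset.subset_univ, true_and]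
    tauto
  · refine Finset.sum_congr rfl fun t ht => ?_
    simp only [Finset.mem_filter, Finset.mem_powersetCard] at ht
    exact h3 t ht.1.2

/-- A five-set without blocks. -/
def GoodFive (D : Finset (Fin 10)) : Prop := D.card = 5 ∧ ∀ b ∈ Bl, ¬ b ⊆ D

instance : DecidablePred (GoodFive Bl) := fun D => by unfold GoodFive; infer_instance

lemma good_compl (h4 : ∀ b ∈ Bl, b.card = 4)
    (h3 : ∀ t : Finset (Fin 10), t.card = 3 → (Bl.filter (fun b => t ⊆ b)).card = 1)
    (D : Finset (Fin 10)) (hD : GoodFive Bl D) : GoodFive Bl Dᶜ := by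
  obtain ⟨hc, hb⟩ := hD
  refine ⟨by rw [Finset.card_compl, hc]; rfl, ?_⟩
  have key : ∀ j ≤ 3, ∑ b ∈ Bl, (b ∩ D).card.choose j * (4 - (b ∩ D).card).choose (3 - j)
      = Nat.choose 5 j * Nat.choose 5 (3 - j) := by
    intro j hj
    have h := sum_blocks Bl h3 (fun S => (S ∩ D).card = j)
    rw [card_three_inter _ _ _ hj] at h
    have h5 : (Finset.univ \ D).card = 5 := by
      rw [← Finset.compl_eq_univ_sdiff, Finset.card_compl, hc]; rfl
    rw [Finset.univ_inter, hc, h5] at h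
    rw [← h]
    refine Finset.sum_congr rfl fun b hbb => ?_
    rw [card_three_inter _ _ _ hj]
    have := Finset.card_inter_add_card_sdiff b D
    have := h4 b hbb
    congr 2
    omega
  have k0 := key 0 (by norm_num)
  have k1 := key 1 (by norm_num)
  have k2 := key 2 (by norm_num)
  have k3 := key 3 (by norm_num)
  -- compare: 3 k0 + k2 = 12 n0 + 3 n1 + 2 n2 + 3 n3, k1 + 3 k3 = 3 n1 + 2 n2 + 3 n3 + 12 n4
  have e : ∑ b ∈ Bl, (12 * (if (b ∩ D).card = 0 then 1 else 0)) = 0 := by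
    have hs : ∀ b ∈ Bl, 3 * ((b ∩ D).card.choose 0 * (4 - (b ∩ D).card).choose (3 - 0))
          + ((b ∩ D).card.choose 2 * (4 - (b ∩ D).card).choose (3 - 2))
        = 12 * (if (b ∩ D).card = 0 then 1 else 0)
          + (((b ∩ D).card.choose 1 * (4 - (b ∩ D).card).choose (3 - 1))
          + 3 * ((b ∩ D).card.choose 3 * (4 - (b ∩ D).card).choose (3 - 3))) := by
      intro b hbb
      have h1 : (b ∩ D).card < 4 := by
        rw [← h4 b hbb]
        refine Finset.card_lt_card ⟨Finset.inter_subset_left, fun h => hb b hbb ?_⟩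
        exact h.trans Finset.inter_subset_right
      generalize (b ∩ D).card = n at h1
      interval_cases n <;> decide
    have := Finset.sum_congr rfl hs
    simp only [Finset.sum_add_distrib, ← Finset.mul_sum] at this
    rw [k0, k1, k2, k3] at this
    rw [← Finset.mul_sum]
    have c1 : Nat.choose 5 2 = 10 := by decide
    have c2 : Nat.choose 5 3 = 10 := by decide
    norm_num [c1, c2] at this ⊢
    simpa using this
  intro b hbb hs
  have := (Finset.sum_eq_zero_iff.1 e) b hbb
  have h0 : (b ∩ D).card = 0 := by
    rw [Finset.card_eq_zero]
    ext x
    have := @hs x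
    simp only [Finset.mem_compl, Finset.mem_inter, Finset.notMem_empty] at *
    tauto
  simp [h0] at this

lemma card_blocks (h4 : ∀ b ∈ Bl, b.card = 4)
    (h3 : ∀ t : Finset (Fin 10), t.card = 3 → (Bl.filter (fun b => t ⊆ b)).card = 1)
    : Bl.card = 30 := by
  have h := sum_blocks Bl h3 (fun _ => True)
  simp only [Finset.filter_true, Finset.card_powersetCard] at h
  rw [Finset.sum_congr rfl (fun b hb => by rw [h4 b hb])] at h
  have c1 : Nat.choose 10 3 = 120 := by decide
  have c2 : Nat.choose 4 3 = 4 := by decide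
  simp [c1] at h
  omega

lemma card_good (h4 : ∀ b ∈ Bl, b.card = 4)
    (h3 : ∀ t : Finset (Fin 10), t.card = 3 → (Bl.filter (fun b => t ⊆ b)).card = 1)
    : (Finset.univ.filter (GoodFive Bl)).card = 72 := by
  have hbl := card_blocks Bl h4 h3
  set F : Finset (Finset (Fin 10)) := (Finset.univ : Finset (Fin 10)).powersetCard 5 with hF
  have := Finset.sum_card_bipartiteAbove_eq_sum_card_bipartiteBelow (s := Bl)
    (t := F) (fun b t => b ⊆ t)
  have h6 : ∀ b ∈ Bl, (F.bipartiteAbove (fun b t => b ⊆ t) b).card = 6 := by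
    intro b hb
    have hb4 := h4 b hb
    have : F.bipartiteAbove (fun b t => b ⊆ t) b = bᶜ.image (fun x => insert x b) := by
      ext t
      simp only [hF, Finset.bipartiteAbove, Finset.mem_filter, Finset.mem_powersetCard,
        Finset.subset_univ, true_and, Finset.mem_image, Finset.mem_compl]
      constructor
      · rintro ⟨h5, hs⟩
        have hc : (t \ b).card = 1 := by rw [Finset.card_sdiff_of_subset hs]; omega
        obtain ⟨x, hx⟩ := Finset.card_eq_one.1 hc
        have hx' : x ∈ t \ b := by rw [hx]; simp
        refine ⟨x, (Finset.mem_sdiff.1 hx').2, ?_⟩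
        rw [Finset.insert_eq, ← hx, Finset.sdiff_union_of_subset hs]
      · rintro ⟨x, hx, rfl⟩
        exact ⟨by rw [Finset.card_insert_of_notMem hx, hb4], Finset.subset_insert _ _⟩
    rw [this, Finset.card_image_of_injOn, Finset.card_compl, hb4]
    · rfl
    · intro x hx y hy hxy
      simp only [Finset.coe_compl, Set.mem_compl_iff, Finset.mem_coe] at hx hy
      have : x ∈ insert y b := by
        have : x ∈ insert x b := Finset.mem_insert_self _ _
        rwa [show insert x b = insert y b from hxy] at this
      simpa [hx] using this
  rw [Finset.sum_congr rfl h6] at this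
  have h1 : ∀ t ∈ F, (Bl.bipartiteBelow (fun b t => b ⊆ t) t).card
      = if GoodFive Bl t then 0 else 1 := by
    intro t ht
    have ht5 : t.card = 5 := (Finset.mem_powersetCard.1 ht).2
    split_ifs with hg
    · rw [Finset.card_eq_zero]
      ext b
      simp only [Finset.bipartiteBelow, Finset.mem_filter, Finset.notMem_empty, iff_false, not_and]
      exact hg.2 b
    · have : ∃ b ∈ Bl, b ⊆ t := by
        by_contra hcon
        push Not at hcon
        exact hg ⟨ht5, hcon⟩
      obtain ⟨b, hb, hbt⟩ := this
      rw [Finset.card_eq_one]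
      refine ⟨b, ?_⟩
      ext c
      simp only [Finset.bipartiteBelow, Finset.mem_filter, Finset.mem_singleton]
      constructor
      · rintro ⟨hc, hct⟩
        have hu := Finset.card_union_add_card_inter b c
        have hu2 := Finset.card_le_card (Finset.union_subset hbt hct)
        have hb4 := h4 b hb
        have hc4 := h4 c hc
        obtain ⟨u, hu, hu3⟩ := Finset.exists_subset_card_eq (show 3 ≤ (b ∩ c).card by omega)
        obtain ⟨z, hz⟩ := Finset.card_eq_one.1 (h3 u hu3)
        have e1 : b ∈ Bl.filter (fun b => u ⊆ b) :=
          Finset.mem_filter.2 ⟨hb, hu.trans Finset.inter_subset_left⟩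
        have e2 : c ∈ Bl.filter (fun b => u ⊆ b) :=
          Finset.mem_filter.2 ⟨hc, hu.trans Finset.inter_subset_right⟩
        rw [hz, Finset.mem_singleton] at e1 e2
        rw [e1, e2]
      · rintro rfl
        exact ⟨hb, hbt⟩
  rw [Finset.sum_congr rfl h1] at this
  have hFc : F.card = 252 := by
    rw [hF, Finset.card_powersetCard]; decide
  have e1 : Finset.univ.filter (GoodFive Bl) = F.filter (GoodFive Bl) := by
    ext t
    simp only [hF, Finset.mem_filter, Finset.mem_univ, true_and, Finset.mem_powersetCard,
      Finset.subset_univ]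
    exact ⟨fun h => ⟨h.1, h⟩, fun h => h.2⟩
  have e2 := Finset.card_filter_add_card_filter_not (s := F) (GoodFive Bl)
  have e3 : ∑ t ∈ F, (if GoodFive Bl t then 0 else 1) = (F.filter (fun t => ¬ GoodFive Bl t)).card := by
    rw [Finset.card_filter]
    refine Finset.sum_congr rfl fun t _ => ?_
    by_cases h : GoodFive Bl t <;> simp [h]
  rw [e3] at this
  simp only [Finset.sum_const, hbl, smul_eq_mul] at this
  rw [e1]
  omega

lemma card_good_zero (h4 : ∀ b ∈ Bl, b.card = 4)
    (h3 : ∀ t : Finset (Fin 10), t.card = 3 → (Bl.filter (fun b => t ⊆ b)).card = 1)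
    :
    (Finset.univ.filter (fun D => GoodFive Bl D ∧ (0 : Fin 10) ∈ D)).card = 36 := by
  have h := card_good Bl h4 h3
  have e2 := Finset.card_filter_add_card_filter_not (s := Finset.univ.filter (GoodFive Bl))
    (fun D => (0 : Fin 10) ∈ D)
  rw [Finset.filter_filter, Finset.filter_filter] at e2
  have e3 : (Finset.univ.filter (fun D => GoodFive Bl D ∧ (0 : Fin 10) ∈ D)).card
      = (Finset.univ.filter (fun D => GoodFive Bl D ∧ (0 : Fin 10) ∉ D)).card := by
    refine Finset.card_nbij' (fun D => Dᶜ) (fun D => Dᶜ) ?_ ?_ ?_ ?_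
    · intro D hD
      simp only [Finset.coe_filter, Finset.mem_univ, true_and, Set.mem_ofPred_eq] at hD ⊢
      exact ⟨good_compl Bl h4 h3 D hD.1, by simpa using hD.2⟩
    · intro D hD
      simp only [Finset.coe_filter, Finset.mem_univ, true_and, Set.mem_ofPred_eq] at hD ⊢
      exact ⟨good_compl Bl h4 h3 D hD.1, by simpa using hD.2⟩
    · intro D _; simp
    · intro D _; simp
  omega

end Design
section Geometry

/-- No three of the projective points `p i` are collinear. -/
def ProjCap (p : Fin 10 → V4) : Prop :=
  ∀ i j k, i ≠ j → i ≠ k → j ≠ k → ∀ x y z : ZMod 3,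
    x • p i + y • p j + z • p k = 0 → x = 0 ∧ y = 0 ∧ z = 0

lemma coeff_aux : ∀ a b c a' b' c' : ZMod 3, a ≠ 0 → b ≠ 0 → c ≠ 0 → a' ≠ 0 → b' ≠ 0 → c' ≠ 0 →
    ∃ s : ZMod 3, (a + s * a' = 0 ∧ b + s * b' = 0) ∨ (a + s * a' = 0 ∧ c + s * c' = 0) ∨
      (b + s * b' = 0 ∧ c + s * c' = 0) := by
  have nz : ∀ x : ZMod 3, x ≠ 0 → x = 1 ∨ x = -1 := by decide
  intro a b c a' b' c' ha hb hc ha' hb' hc'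
  rcases nz a ha with rfl | rfl <;> rcases nz b hb with rfl | rfl <;>
    rcases nz c hc with rfl | rfl <;> rcases nz a' ha' with rfl | rfl <;>
    rcases nz b' hb' with rfl | rfl <;> rcases nz c' hc' with rfl | rfl <;> decide

variable {p : Fin 10 → V4}

lemma coeff_ne (H : ProjCap p) {i j k l : Fin 10} (hjk : j ≠ k) (hjl : j ≠ l) (hkl : k ≠ l)
    {a b c : ZMod 3} (h : p l = a • p i + b • p j + c • p k) : a ≠ 0 := by
  rintro rfl
  have := H j k l hjk hjl hkl b c (-1) (by rw [h]; module)
  exact absurd this.2.2 (by decide)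

lemma mate_unique (H : ProjCap p) {i j k l m : Fin 10} (hij : i ≠ j) (hik : i ≠ k) (hjk : j ≠ k)
    (hil : i ≠ l) (hjl : j ≠ l) (hkl : k ≠ l) (him : i ≠ m) (hjm : j ≠ m) (hkm : k ≠ m)
    (hlm : l ≠ m) {a b c a' b' c' : ZMod 3} (h : p l = a • p i + b • p j + c • p k)
    (h' : p m = a' • p i + b' • p j + c' • p k) : False := by
  have ha := coeff_ne H hjk hjl hkl h
  have hb := coeff_ne H (i := j) (a := b) (b := a) (c := c) hik hil hkl (by rw [h]; module)
  have hc := coeff_ne H (i := k) (a := c) (b := a) (c := b) hij hil hjl (by rw [h]; module)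
  have ha' := coeff_ne H hjk hjm hkm h'
  have hb' := coeff_ne H (i := j) (a := b') (b := a') (c := c') hik him hkm (by rw [h']; module)
  have hc' := coeff_ne H (i := k) (a := c') (b := a') (c := b') hij him hjm (by rw [h']; module)
  have one : (1 : ZMod 3) ≠ 0 := by decide
  have e : ∀ s : ZMod 3, p l + s • p m
      = (a + s * a') • p i + (b + s * b') • p j + (c + s * c') • p k := by
    intro s; rw [h, h']; module
  obtain ⟨s, ⟨h1, h2⟩ | ⟨h1, h2⟩ | ⟨h1, h2⟩⟩ := coeff_aux a b c a' b' c' ha hb hc ha' hb' hc'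
  · have es := e s
    rw [h1, h2] at es
    refine one (H l m k hlm hkl.symm hkm.symm 1 s (-(c + s * c')) ?_).1
    rw [one_smul, es]; module
  · have es := e s
    rw [h1, h2] at es
    refine one (H l m j hlm hjl.symm hjm.symm 1 s (-(b + s * b')) ?_).1
    rw [one_smul, es]; module
  · have es := e s
    rw [h1, h2] at es
    refine one (H l m i hlm hil.symm him.symm 1 s (-(a + s * a')) ?_).1
    rw [one_smul, es]; module

lemma exists_third (i j : Fin 10) : ∃ k, i ≠ k ∧ j ≠ k := by
  revert i j; decide

lemma finrank_pair (H : ProjCap p) {i j : Fin 10} (hij : i ≠ j) :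
    Module.finrank (ZMod 3) (Submodule.span (ZMod 3) {p i, p j}) = 2 := by
  have : LinearIndependent (ZMod 3) ![p i, p j] := by
    rw [LinearIndependent.pair_iff]
    intro s t hst
    obtain ⟨k, hik, hjk⟩ := exists_third i j
    have := H i j k hij hik hjk s t 0 (by rw [hst]; simp)
    exact ⟨this.1, this.2.1⟩
  have h := finrank_span_eq_card this
  have hr : Set.range ![p i, p j] = {p i, p j} := by
    ext x; simp; tauto
  rw [hr] at h
  simpa using h

lemma finrank_triple (H : ProjCap p) {i j k : Fin 10} (hij : i ≠ j) (hik : i ≠ k) (hjk : j ≠ k) :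
    Module.finrank (ZMod 3) (Submodule.span (ZMod 3) {p i, p j, p k}) = 3 := by
  have : LinearIndependent (ZMod 3) ![p i, p j, p k] := by
    rw [Fintype.linearIndependent_iff]
    intro g hg
    simp only [Fin.sum_univ_three] at hg
    have := H i j k hij hik hjk (g 0) (g 1) (g 2) (by simpa using hg)
    intro q
    fin_cases q
    · exact this.1
    · exact this.2.1
    · exact this.2.2
  have h := finrank_span_eq_card this
  have hr : Set.range ![p i, p j, p k] = {p i, p j, p k} := by
    ext x; simp; tauto
  rw [hr, Fintype.card_fin] at h
  exact h

lemma class_fun : ∃ g : (Fin 2 → ZMod 3) → Fin 4, ∀ u v, u ≠ 0 → v ≠ 0 → g u = g v →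
    u = v ∨ u = -v := by
  refine ⟨fun u => if u 0 = 0 then 0 else if u 1 = 0 then 1 else if u 0 = u 1 then 2 else 3, ?_⟩
  decide

lemma mate_exists (H : ProjCap p) {i j k : Fin 10} (hij : i ≠ j) (hik : i ≠ k) (hjk : j ≠ k) :
    ∃ l, i ≠ l ∧ j ≠ l ∧ k ≠ l ∧ ∃ a b c : ZMod 3, p l = a • p i + b • p j + c • p k := by
  obtain ⟨g, hg⟩ := class_fun
  set U := Submodule.span (ZMod 3) {p i, p j} with hU
  have hq : Module.finrank (ZMod 3) (V4 ⧸ U) = 2 := by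
    have := Submodule.finrank_quotient_add_finrank U
    rw [finrank_pair H hij] at this
    simp at this
    omega
  let e : (V4 ⧸ U) ≃ₗ[ZMod 3] (Fin 2 → ZMod 3) :=
    LinearEquiv.ofFinrankEq _ _ (by rw [hq]; simp)
  let f : V4 →ₗ[ZMod 3] (Fin 2 → ZMod 3) := e.toLinearMap ∘ₗ U.mkQ
  have hf : ∀ v, f v = 0 → ∃ a b : ZMod 3, a • p i + b • p j = v := by
    intro v hv
    have : U.mkQ v = 0 := by simpa [f] using hv
    rw [Submodule.mkQ_apply, Submodule.Quotient.mk_eq_zero] at this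
    exact Submodule.mem_span_pair.1 this
  have hne : ∀ x, i ≠ x → j ≠ x → f (p x) ≠ 0 := by
    intro x hx hx' h0
    obtain ⟨a, b, hab⟩ := hf _ h0
    have := (H i j x hij hx hx' a b (-1) (by rw [← hab]; module)).2.2
    exact absurd this (by decide)
  have hrel : ∀ x y, i ≠ x → j ≠ x → i ≠ y → j ≠ y → g (f (p x)) = g (f (p y)) →
      ∃ a b c : ZMod 3, p y = a • p i + b • p j + c • p x := by
    intro x y h1 h2 h3 h4 he
    rcases hg _ _ (hne x h1 h2) (hne y h3 h4) he with h | h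
    · obtain ⟨a, b, hab⟩ := hf (p y - p x) (by rw [map_sub, h, sub_self])
      exact ⟨a, b, 1, by rw [hab]; module⟩
    · obtain ⟨a, b, hab⟩ := hf (p y + p x) (by rw [map_add, h, add_neg_cancel])
      exact ⟨a, b, -1, by rw [hab]; module⟩
  by_contra hcon
  push Not at hcon
  have hX : (Finset.univ \ {i, j, k} : Finset (Fin 10)).card = 7 := by
    rw [← Finset.compl_eq_univ_sdiff, Finset.card_compl, Finset.card_eq_three.2 ⟨i, j, k, hij, hik, hjk, rfl⟩]; rfl
  obtain ⟨y, hy, hlt⟩ := Finset.exists_lt_card_fiber_of_mul_lt_card_of_maps_to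
    (s := (Finset.univ \ {i, j, k} : Finset (Fin 10))) (t := Finset.univ.erase (g (f (p k))))
    (f := fun x => g (f (p x))) (n := 2) (by
      intro x hx
      simp only [Finset.mem_sdiff, Finset.mem_univ, true_and, Finset.mem_insert,
        Finset.mem_singleton, not_or] at hx
      simp only [Finset.mem_erase, Finset.mem_univ, and_true]
      intro he
      obtain ⟨a, b, c, h⟩ := hrel k x hik hjk (Ne.symm hx.1) (Ne.symm hx.2.1) he.symm
      exact hcon x (Ne.symm hx.1) (Ne.symm hx.2.1) (Ne.symm hx.2.2) a b c h)
    (by rw [hX, Finset.card_erase_of_mem (Finset.mem_univ _)]; simp)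
  obtain ⟨x, z, w, hx, hz, hw, hxz, hxw, hzw⟩ := Finset.two_lt_card_iff.1 hlt
  simp only [Finset.mem_filter, Finset.mem_sdiff, Finset.mem_univ, true_and, Finset.mem_insert,
        Finset.mem_singleton, not_or] at hx hz hw
  obtain ⟨⟨x1, x2, -⟩, xe⟩ := hx
  obtain ⟨⟨z1, z2, -⟩, ze⟩ := hz
  obtain ⟨⟨w1, w2, -⟩, we⟩ := hw
  obtain ⟨a, b, c, h⟩ := hrel x z (Ne.symm x1) (Ne.symm x2) (Ne.symm z1) (Ne.symm z2) (xe.trans ze.symm)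
  obtain ⟨a', b', c', hmate⟩ := hrel x w (Ne.symm x1) (Ne.symm x2) (Ne.symm w1) (Ne.symm w2) (xe.trans we.symm)
  exact mate_unique H hij (Ne.symm x1) (Ne.symm x2) (Ne.symm z1) (Ne.symm z2) hxz
    (Ne.symm w1) (Ne.symm w2) hxw hzw h hmate

/-- The indices in `s` span at most a plane. -/
def CoplanarIdx (p : Fin 10 → V4) (s : Finset (Fin 10)) : Prop :=
  ∃ W : Submodule (ZMod 3) V4, Module.finrank (ZMod 3) W = 3 ∧ ∀ i ∈ s, p i ∈ W

open Classical in
/-- The blocks: coplanar quadruples. -/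
noncomputable def blocks (p : Fin 10 → V4) : Finset (Finset (Fin 10)) :=
  Finset.univ.filter (fun s => s.card = 4 ∧ CoplanarIdx p s)

lemma mem_blocks {s : Finset (Fin 10)} : s ∈ blocks p ↔ s.card = 4 ∧ CoplanarIdx p s := by
  simp [blocks]

lemma blocks_three (H : ProjCap p) (t : Finset (Fin 10)) (ht : t.card = 3) :
    ((blocks p).filter (fun b => t ⊆ b)).card = 1 := by
  obtain ⟨i, j, k, hij, hik, hjk, rfl⟩ := Finset.card_eq_three.1 ht
  obtain ⟨l, hil, hjl, hkl, a, b, c, h⟩ := mate_exists H hij hik hjk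
  have hW := finrank_triple H hij hik hjk
  have hl : l ∉ ({i, j, k} : Finset (Fin 10)) := by
    simp [Ne.symm hil, Ne.symm hjl, Ne.symm hkl]
  rw [Finset.card_eq_one]
  refine ⟨insert l {i, j, k}, ?_⟩
  ext s
  simp only [Finset.mem_filter, mem_blocks, Finset.mem_singleton]
  constructor
  · rintro ⟨⟨hs4, W, hWr, hWs⟩, hts⟩
    have hc : (s \ {i, j, k}).card = 1 := by rw [Finset.card_sdiff_of_subset hts]; omega
    obtain ⟨m, hm⟩ := Finset.card_eq_one.1 hc
    have hm' : m ∈ s \ {i, j, k} := by rw [hm]; simp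
    have hs : s = insert m {i, j, k} := by
      rw [Finset.insert_eq, ← hm, Finset.sdiff_union_of_subset hts]
    simp only [Finset.mem_sdiff, Finset.mem_insert, Finset.mem_singleton, not_or] at hm'
    obtain ⟨hms, m1, m2, m3⟩ := hm'
    have hle : Submodule.span (ZMod 3) {p i, p j, p k} ≤ W := by
      rw [Submodule.span_le]
      rintro x (rfl | rfl | rfl)
      · exact hWs _ (hts (by simp))
      · exact hWs _ (hts (by simp))
      · exact hWs _ (hts (by simp))
    have heq := Submodule.eq_of_le_of_finrank_eq hle (by rw [hW, hWr])
    have hmW := hWs m hms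
    rw [← heq, Submodule.mem_span_triple] at hmW
    obtain ⟨a', b', c', h'⟩ := hmW
    by_cases hlm : l = m
    · rw [hs, hlm]
    · exact (mate_unique H hij hik hjk hil hjl hkl (Ne.symm m1) (Ne.symm m2) (Ne.symm m3) hlm
        h h'.symm).elim
  · rintro rfl
    refine ⟨⟨by rw [Finset.card_insert_of_notMem hl, ht], _, hW, ?_⟩, Finset.subset_insert _ _⟩
    intro x hx
    simp only [Finset.mem_insert, Finset.mem_singleton] at hx
    rcases hx with rfl | rfl | rfl | rfl
    · rw [Submodule.mem_span_triple]; exact ⟨a, b, c, h.symm⟩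
    all_goals exact Submodule.subset_span (by simp)

end Geometry
section Transfer

/-- The symmetric point set around `a` with indices in `s`. -/
def symSet (a : V4) (p : Fin 10 → V4) (s : Finset (Fin 10)) : Finset V4 :=
  s.image (fun i => a + p i) ∪ s.image (fun i => a - p i)

lemma mem_symSet {a : V4} {p : Fin 10 → V4} {s : Finset (Fin 10)} {x : V4} :
    x ∈ symSet a p s ↔ ∃ i ∈ s, a + p i = x ∨ a - p i = x := by
  simp only [symSet, Finset.mem_union, Finset.mem_image]
  constructor
  · rintro (⟨i, hi, h⟩ | ⟨i, hi, h⟩)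
    · exact ⟨i, hi, Or.inl h⟩
    · exact ⟨i, hi, Or.inr h⟩
  · rintro ⟨i, hi, h | h⟩
    · exact Or.inl ⟨i, hi, h⟩
    · exact Or.inr ⟨i, hi, h⟩

lemma three_zero (v : V4) : v + v + v = 0 := by
  ext i
  have : ∀ x : ZMod 3, x + x + x = 0 := by decide
  exact this (v i)

variable {a : V4} {p : Fin 10 → V4}

lemma ProjCap.ne_zero (H : ProjCap p) (i : Fin 10) : p i ≠ 0 := by
  intro h
  obtain ⟨j, hj, -⟩ := exists_third i i
  obtain ⟨k, hk, hjk⟩ := exists_third i j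
  exact absurd (H i j k hj hk hjk 1 0 0 (by rw [h]; simp)).1 (by decide)

lemma ProjCap.inj (H : ProjCap p) {i j : Fin 10} (h : p i = p j) : i = j := by
  by_contra hij
  obtain ⟨k, hk, hjk⟩ := exists_third i j
  exact absurd (H i j k hij hk hjk 1 (-1) 0 (by rw [h]; simp)).1 (by decide)

lemma ProjCap.inj_neg (H : ProjCap p) {i j : Fin 10} (h : p i = - p j) : i = j := by
  by_contra hij
  obtain ⟨k, hk, hjk⟩ := exists_third i j
  exact absurd (H i j k hij hk hjk 1 1 0 (by rw [h]; simp)).1 (by decide)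

lemma ProjCap.ne_neg (H : ProjCap p) {i j : Fin 10} (h : p i = - p j) : False := by
  have := H.inj_neg h
  subst this
  apply H.ne_zero i
  have h3 := three_zero (p i)
  rw [show p i + p i = 0 from by nth_rewrite 1 [h]; simp, zero_add] at h3
  exact h3

lemma card_symSet (H : ProjCap p) (s : Finset (Fin 10)) : (symSet a p s).card = 2 * s.card := by
  rw [symSet, Finset.card_union_of_disjoint, Finset.card_image_of_injective,
    Finset.card_image_of_injective]
  · omega
  · intro i j h
    exact H.inj (by simpa using h)
  · intro i j h
    exact H.inj (by simpa using h)
  · rw [Finset.disjoint_left]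
    intro x hx hx'
    simp only [Finset.mem_image] at hx hx'
    obtain ⟨i, _, rfl⟩ := hx
    obtain ⟨j, _, h⟩ := hx'
    refine H.ne_neg (i := i) (j := j) ?_
    rw [sub_eq_add_neg] at h
    exact (add_left_cancel h).symm

lemma plus_mem_symSet (H : ProjCap p) {s : Finset (Fin 10)} {i : Fin 10} :
    a + p i ∈ symSet a p s ↔ i ∈ s := by
  rw [mem_symSet]
  constructor
  · rintro ⟨j, hj, h | h⟩
    · rwa [← H.inj (add_left_cancel h)]
    · rw [sub_eq_add_neg] at h
      exact (H.ne_neg (add_left_cancel h).symm).elim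
  · intro h
    exact ⟨i, h, Or.inl rfl⟩

lemma minus_mem_symSet (H : ProjCap p) {s : Finset (Fin 10)} {i : Fin 10} :
    a - p i ∈ symSet a p s ↔ i ∈ s := by
  rw [mem_symSet]
  constructor
  · rintro ⟨j, hj, h | h⟩
    · rw [sub_eq_add_neg] at h
      exact (H.ne_neg (add_left_cancel h)).elim
    · rwa [← H.inj (sub_right_injective h)]
  · intro h
    exact ⟨i, h, Or.inr rfl⟩

lemma symSet_inj (H : ProjCap p) {s t : Finset (Fin 10)} (h : symSet a p s = symSet a p t) :
    s = t := by
  ext i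
  rw [← plus_mem_symSet (a := a) H, h, plus_mem_symSet H]

lemma symSet_compl (H : ProjCap p) (s : Finset (Fin 10)) :
    symSet a p Finset.univ \ symSet a p s = symSet a p sᶜ := by
  ext x
  rw [Finset.mem_sdiff]
  constructor
  · rintro ⟨h1, h2⟩
    obtain ⟨i, -, rfl | rfl⟩ := mem_symSet.1 h1
    · rw [plus_mem_symSet H] at h2 ⊢
      simpa using h2
    · rw [minus_mem_symSet H] at h2 ⊢
      simpa using h2
  · intro h1
    obtain ⟨i, hi, rfl | rfl⟩ := mem_symSet.1 h1
    · rw [plus_mem_symSet H, plus_mem_symSet H]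
      simpa using hi
    · rw [minus_mem_symSet H, minus_mem_symSet H]
      simpa using hi

lemma demicap_of_good (H : ProjCap p) (hcap : IsCap (↑(symSet a p Finset.univ) : Set V4))
    {s : Finset (Fin 10)} (hs : GoodFive (blocks p) s) : IsDemicap a (symSet a p s) := by
  refine ⟨by rw [card_symSet H, hs.1], ?_, fun i => a + p (s.orderEmbOfFin hs.1 i),
    fun i => a - p (s.orderEmbOfFin hs.1 i), ?_, ?_, ?_⟩
  · have hsub : symSet a p s ⊆ symSet a p Finset.univ := by
      intro x hx
      obtain ⟨i, hi, h⟩ := mem_symSet.1 hx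
      exact mem_symSet.2 ⟨i, Finset.mem_univ _, h⟩
    intro x hx y hy z hz
    exact hcap x (hsub hx) y (hsub hy) z (hsub hz)
  · intro i
    have := three_zero a
    beta_reduce
    generalize p (s.orderEmbOfFin hs.1 i) = v
    rw [show a + (a + v) + (a - v) = a + a + a by abel, this]
  · have hr : s = Finset.univ.image (s.orderEmbOfFin hs.1) := by
      ext x
      have := Finset.range_orderEmbOfFin s hs.1
      have h2 : x ∈ Set.range (s.orderEmbOfFin hs.1) ↔ x ∈ (s : Set (Fin 10)) := by rw [this]
      simp only [Set.mem_range, Finset.mem_coe] at h2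
      simp
    conv_lhs => rw [hr]
    rw [symSet, Finset.image_image, Finset.image_image]
    rfl
  · rintro ⟨t, ht, W, hW, hWt⟩
    refine hs.2 (t.map (s.orderEmbOfFin hs.1).toEmbedding) (mem_blocks.2 ⟨by simpa using ht, W, hW, ?_⟩) ?_
    · intro i hi
      obtain ⟨j, hj, rfl⟩ := Finset.mem_map.1 hi
      simpa using hWt j hj
    · intro i hi
      obtain ⟨j, hj, rfl⟩ := Finset.mem_map.1 hi
      exact Finset.orderEmbOfFin_mem s hs.1 j

lemma good_of_demicap (H : ProjCap p) {D : Finset V4} (hD : IsDemicap a D)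
    (hsub : D ⊆ symSet a p Finset.univ) :
    ∃ s, GoodFive (blocks p) s ∧ D = symSet a p s := by
  obtain ⟨hc, -, d, d', hdd, hDe, hno⟩ := hD
  have h3 := three_zero a
  have hd' : ∀ i, d' i = a + a - d i := by
    intro i
    have h := hdd i
    have : d' i = (a + d i + d' i) - (a + a + a) + (a + a - d i) := by abel
    rw [this, h, h3]; abel
  have hmem : ∀ v, a + v ∈ D ↔ ∃ j, d j = a + v ∨ d j = a - v := by
    intro v
    rw [hDe]
    simp only [Finset.mem_union, Finset.mem_image, Finset.mem_univ, true_and]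
    have : ∀ j, d' j = a + v ↔ d j = a - v := by
      intro j
      rw [hd' j]
      constructor
      · intro h
        rw [show a - v = a + a - (a + v) by abel, ← h]; abel
      · intro h; rw [h]; abel
    simp only [this, exists_or]
  have hsym : ∀ v, a - v ∈ D ↔ a + v ∈ D := by
    intro v
    rw [sub_eq_add_neg, hmem, hmem]
    simp only [sub_neg_eq_add, ← sub_eq_add_neg]
    exact exists_congr fun j => or_comm
  have hDs : D = symSet a p (Finset.univ.filter (fun i => a + p i ∈ D)) := by
    ext x
    constructor
    · intro hx
      obtain ⟨i, -, rfl | rfl⟩ := mem_symSet.1 (hsub hx)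
      · rw [plus_mem_symSet H]; simpa using hx
      · rw [minus_mem_symSet H]; simpa [hsym] using hx
    · intro hx
      obtain ⟨i, hi, rfl | rfl⟩ := mem_symSet.1 hx
      · simpa using hi
      · rw [hsym]; simpa using hi
  refine ⟨Finset.univ.filter (fun i => a + p i ∈ D), ⟨?_, ?_⟩, hDs⟩
  · rw [hDs, card_symSet H] at hc
    omega
  · intro b hb hbs
    obtain ⟨hb4, W, hW, hWb⟩ := mem_blocks.1 hb
    have hj : ∀ i : Fin 10, ∃ j, i ∈ b → d j = a + p i ∨ d j = a - p i := by
      intro i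
      by_cases hi : i ∈ b
      · have : a + p i ∈ D := by simpa using hbs hi
        obtain ⟨j, hj⟩ := (hmem _).1 this
        exact ⟨j, fun _ => hj⟩
      · exact ⟨0, fun h => (hi h).elim⟩
    choose f hf using hj
    refine hno ⟨b.image f, ?_, W, hW, ?_⟩
    · rw [Finset.card_image_of_injOn, hb4]
      intro i hi k hk hik
      have h1 := hf i hi
      have h2 := hf k hk
      rw [show f i = f k from hik] at h1
      rcases h1 with h1 | h1 <;> rcases h2 with h2 | h2 <;> rw [h1] at h2
      · exact H.inj (add_left_cancel h2)
      · rw [sub_eq_add_neg] at h2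
        exact H.inj_neg (add_left_cancel h2)
      · rw [sub_eq_add_neg] at h2
        exact (H.inj_neg (add_left_cancel h2).symm).symm
      · exact H.inj (sub_right_injective h2)
    · intro j hj
      obtain ⟨i, hi, rfl⟩ := Finset.mem_image.1 hj
      rcases hf i hi with h | h <;> rw [h]
      · simpa using hWb i hi
      · simpa using hWb i hi

/-- A choice of one vector from each pair of opposite vectors. -/
def posVec (v : V4) : Bool :=
  if v 0 ≠ 0 then v 0 = 1 else if v 1 ≠ 0 then v 1 = 1 else if v 2 ≠ 0 then v 2 = 1 else v 3 = 1

set_option maxRecDepth 100000 in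
lemma posVec_neg : ∀ v : V4, v ≠ 0 → (posVec (-v) = true ↔ ¬ posVec v = true) := by
  decide +kernel

lemma exists_param (a : V4) (C : Finset V4)
    (hcap : IsCap (↑C : Set V4)) (hcard : C.card = 20)
    (ha : a ∉ C) (hanchor : ∀ x ∈ C, -a - x ∈ C) :
    ∃ p : Fin 10 → V4, ProjCap p ∧ C = symSet a p Finset.univ := by
  have h3 := three_zero a
  have hneg : ∀ v, a + v ∈ C → a - v ∈ C := by
    intro v hv
    have := hanchor _ hv
    rwa [show -a - (a + v) = a - v - (a + a + a) by abel, h3, sub_zero] at this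
  set E : Finset V4 := Finset.univ.filter (fun v => a + v ∈ C) with hE
  have hEc : E.card = 20 := by
    rw [← hcard]
    refine Finset.card_nbij' (fun v => a + v) (fun x => x - a) ?_ ?_ ?_ ?_
    · intro v hv; simpa [hE] using hv
    · intro v hv; simpa [hE] using hv
    · intro v hv; simp
    · intro v hv; simp
  have hEn : ∀ v ∈ E, -v ∈ E := by
    intro v hv
    simp only [hE, Finset.mem_filter, Finset.mem_univ, true_and] at hv ⊢
    rw [← sub_eq_add_neg]; exact hneg v hv
  have hE0 : ∀ v ∈ E, v ≠ 0 := by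
    rintro v hv rfl
    simp [hE, ha] at hv
  have hT : (E.filter (fun v => posVec v = true)).card = 10 := by
    have e := Finset.card_filter_add_card_filter_not (s := E) (fun v => posVec v = true)
    have : (E.filter (fun v => posVec v = true)).card
        = (E.filter (fun v => ¬ posVec v = true)).card := by
      refine Finset.card_nbij' (fun v => -v) (fun v => -v) ?_ ?_ ?_ ?_
      · intro v hv
        have hv := Finset.mem_filter.1 (Finset.mem_coe.1 hv)
        refine Finset.mem_coe.2 (Finset.mem_filter.2 ⟨hEn v hv.1, ?_⟩)
        rw [posVec_neg v (hE0 v hv.1)]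
        exact not_not.2 hv.2
      · intro v hv
        have hv := Finset.mem_filter.1 (Finset.mem_coe.1 hv)
        refine Finset.mem_coe.2 (Finset.mem_filter.2 ⟨hEn v hv.1, ?_⟩)
        rw [posVec_neg v (hE0 v hv.1)]
        exact hv.2
      · intro v _; simp
      · intro v _; simp
    omega
  let q := (Finset.equivFinOfCardEq hT).symm
  let p : Fin 10 → V4 := fun i => (q i : V4)
  have hpT : ∀ i, p i ∈ E ∧ posVec (p i) = true := fun i => Finset.mem_filter.1 (q i).2
  have hpinj : ∀ i j, p i = p j → i = j := fun i j h => q.injective (Subtype.ext h)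
  have hpn : ∀ i j, p i ≠ - p j := by
    intro i j h
    have h1 := (hpT i).2
    rw [h, posVec_neg _ (hE0 _ (hpT j).1)] at h1
    exact h1 (hpT j).2
  have hnz : ∀ x : ZMod 3, x = 0 ∨ x = 1 ∨ x = -1 := by decide
  have hmul : ∀ (x : ZMod 3) i, x ≠ 0 → x • p i ∈ E := by
    intro x i hx
    rcases hnz x with h | h | h
    · exact (hx h).elim
    · rw [h, one_smul]; exact (hpT i).1
    · rw [h, neg_one_smul]; exact hEn _ (hpT i).1
  have hdist : ∀ (x y : ZMod 3) i j, i ≠ j → x ≠ 0 → x • p i ≠ y • p j := by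
    intro x y i j hij hx h
    rcases hnz x with hx' | rfl | rfl
    · exact hx hx'
    · rcases hnz y with rfl | rfl | rfl
      · simp only [one_smul, zero_smul] at h
        exact hE0 _ (hpT i).1 h
      · simp only [one_smul] at h
        exact hij (hpinj _ _ h)
      · simp only [one_smul, neg_one_smul] at h
        exact hpn _ _ h
    · rcases hnz y with rfl | rfl | rfl
      · simp only [neg_one_smul, zero_smul, neg_eq_zero] at h
        exact hE0 _ (hpT i).1 h
      · simp only [one_smul, neg_one_smul] at h
        exact hpn _ _ h.symm
      · simp only [neg_one_smul, neg_inj] at h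
        exact hij (hpinj _ _ h)
  refine ⟨p, ?_, ?_⟩
  · intro i j k hij hik hjk x y z h
    have hx0 : x = 0 ∨ y = 0 ∨ z = 0 := by
      by_contra hcon
      push Not at hcon
      obtain ⟨hx, hy, hz⟩ := hcon
      have m1 := hmul x i hx
      have m2 := hmul y j hy
      have m3 := hmul z k hz
      simp only [hE, Finset.mem_filter, Finset.mem_univ, true_and] at m1 m2 m3
      refine hcap _ m1 _ m2 _ m3 ?_ ?_ ?_ ?_
      · intro e; exact hdist x y i j hij hx (add_left_cancel e)
      · intro e; exact hdist x z i k hik hx (add_left_cancel e)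
      · intro e; exact hdist y z j k hjk hy (add_left_cancel e)
      · rw [show a + x • p i + (a + y • p j) + (a + z • p k)
          = (a + a + a) + (x • p i + y • p j + z • p k) by abel, h, h3, add_zero]
    have two : ∀ (x y : ZMod 3) i j, i ≠ j → x • p i + y • p j = 0 → x = 0 ∧ y = 0 := by
      intro x y i j hij h
      have hx : x = 0 := by
        by_contra hx
        refine hdist x (-y) i j hij hx ?_
        rw [neg_smul]; exact eq_neg_of_add_eq_zero_left h
      refine ⟨hx, ?_⟩
      by_contra hy
      refine hdist y (-x) j i hij.symm hy ?_
      rw [neg_smul]; exact eq_neg_of_add_eq_zero_right h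
    rcases hx0 with rfl | rfl | rfl
    · have := two y z j k hjk (by simpa using h)
      exact ⟨rfl, this⟩
    · have := two x z i k hik (by simpa using h)
      exact ⟨this.1, rfl, this.2⟩
    · have := two x y i j hij (by simpa using h)
      exact ⟨this.1, this.2, rfl⟩
  · have hsurj : ∀ v ∈ E, posVec v = true → ∃ i, p i = v := by
      intro v hv hp
      exact ⟨q.symm ⟨v, Finset.mem_filter.2 ⟨hv, hp⟩⟩, by simp [p]⟩
    have hmE : ∀ v, v ∈ E ↔ a + v ∈ C := by intro v; simp [hE]
    ext x
    rw [mem_symSet]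
    constructor
    · intro hx
      have hxE : x - a ∈ E := by rw [hmE]; simpa using hx
      by_cases hp : posVec (x - a) = true
      · obtain ⟨i, hi⟩ := hsurj _ hxE hp
        exact ⟨i, Finset.mem_univ _, Or.inl (by rw [hi]; abel)⟩
      · rw [← posVec_neg _ (hE0 _ hxE)] at hp
        obtain ⟨i, hi⟩ := hsurj _ (hEn _ hxE) hp
        exact ⟨i, Finset.mem_univ _, Or.inr (by rw [hi]; abel)⟩
    · rintro ⟨i, -, rfl | rfl⟩
      · exact (hmE _).1 (hpT i).1
      · exact hneg _ ((hmE _).1 (hpT i).1)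

end Transfer

/-- The complement in a maximal cap of a demicap is a demicap, and a maximal cap is
a disjoint union of two demicaps in exactly 36 ways. -/
theorem complement_of_demicap (a : V4) (C : Finset V4)
    (hcap : IsCap (↑C : Set V4)) (hcard : C.card = 20)
    (ha : a ∉ C) (hanchor : ∀ x ∈ C, -a - x ∈ C) :
    (∀ D : Finset V4, IsDemicap a D → D ⊆ C → IsDemicap a (C \ D)) ∧
    {P : Sym2 (Finset V4) | ∃ D₁ D₂ : Finset V4, P = s(D₁, D₂) ∧
      IsDemicap a D₁ ∧ IsDemicap a D₂ ∧ Disjoint D₁ D₂ ∧ D₁ ∪ D₂ = C}.ncard = 36 := by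
  obtain ⟨p, H, rfl⟩ := exists_param a C hcap hcard ha hanchor
  have h4 : ∀ b ∈ blocks p, b.card = 4 := fun b hb => (mem_blocks.1 hb).1
  have h3 := blocks_three H
  constructor
  · intro D hD hsub
    obtain ⟨s, hs, rfl⟩ := good_of_demicap H hD hsub
    rw [symSet_compl H]
    exact demicap_of_good H hcap (good_compl _ h4 h3 s hs)
  · rw [← card_good_zero (blocks p) h4 h3, ← Set.ncard_coe_finset]
    symm
    refine Set.ncard_congr (fun s _ => s(symSet a p s, symSet a p sᶜ)) ?_ ?_ ?_
    · intro s hs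
      have hs := (Finset.mem_filter.1 (Finset.mem_coe.1 hs)).2.1
      refine ⟨_, _, rfl, demicap_of_good H hcap hs,
        demicap_of_good H hcap (good_compl _ h4 h3 s hs), ?_, ?_⟩
      · rw [← symSet_compl H]; exact Finset.disjoint_sdiff
      · rw [← symSet_compl H]
        refine Finset.union_sdiff_of_subset ?_
        intro x hx
        obtain ⟨i, hi, h⟩ := mem_symSet.1 hx
        exact mem_symSet.2 ⟨i, Finset.mem_univ _, h⟩
    · intro s t hs ht hst
      have hs := (Finset.mem_filter.1 (Finset.mem_coe.1 hs)).2.2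
      have ht := (Finset.mem_filter.1 (Finset.mem_coe.1 ht)).2.2
      rw [Sym2.eq_iff] at hst
      rcases hst with h | h
      · exact symSet_inj H h.1
      · have := symSet_inj H h.1
        rw [this] at hs
        exact absurd ht (Finset.mem_compl.1 hs)
    · rintro P ⟨D₁, D₂, rfl, hD₁, hD₂, hdis, hun⟩
      obtain ⟨s, hs, rfl⟩ := good_of_demicap H hD₁ (hun ▸ Finset.subset_union_left)
      have h2 : D₂ = symSet a p sᶜ := by
        rw [← symSet_compl H, ← hun, Finset.union_sdiff_cancel_left hdis]
      subst h2
      by_cases h0 : (0 : Fin 10) ∈ s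
      · exact ⟨s, Finset.mem_coe.2 (Finset.mem_filter.2 ⟨Finset.mem_univ _, hs, h0⟩), rfl⟩
      · refine ⟨sᶜ, Finset.mem_coe.2 (Finset.mem_filter.2 ⟨Finset.mem_univ _,
          good_compl _ h4 h3 s hs, Finset.mem_compl.2 h0⟩), ?_⟩
        rw [compl_compl, Sym2.eq_swap]
end

section
/- Let C be a 20-point cap in (ZMod 3)^4 and let H_1, H_2, H_3 be the three parallel affine hyperplanes determined by a fixed nonzero linear functional, with the anchor point a of C lying in H_1. Then |C ∩ H_2| = |C ∩ H_3|, and |C ∩ H_1| ∈ {2, 8}. -/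
/-- symmetric cap avoiding the origin -/
structure SymCap (S : Finset V4) : Prop where
  neg : ∀ x ∈ S, -x ∈ S
  zero : (0 : V4) ∉ S
  cap : ∀ a ∈ S, ∀ b ∈ S, ∀ c ∈ S, a ≠ b → a ≠ c → b ≠ c → a + b + c ≠ 0

theorem zmod3_cases (α : ZMod 3) : α = 0 ∨ α = 1 ∨ α = -1 := by
  revert α; decide

theorem three_v4 (x : V4) : x + x + x = 0 := by
  ext i
  simp only [Pi.add_apply, Pi.zero_apply]
  generalize x i = t
  revert t; decide

theorem v4_ne_neg {x : V4} (hx : x ≠ 0) : x ≠ -x := by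
  intro h
  apply hx
  have h3 := three_v4 x
  have h2 : x + x = 0 := by nth_rewrite 2 [h]; simp
  rw [h2, zero_add] at h3
  exact h3

theorem SymCap.smul {S : Finset V4} (h : SymCap S) {x : V4} (hx : x ∈ S) {α : ZMod 3}
    (hα : α ≠ 0) : α • x ∈ S := by
  rcases zmod3_cases α with r | r | r
  · exact absurd r hα
  · subst r; simpa using hx
  · subst r; simpa using h.neg x hx

theorem smul_ne_smul_of {x y : V4} (h1 : x ≠ y) (h2 : x ≠ -y) {α β : ZMod 3}
    (hα : α ≠ 0) (hβ : β ≠ 0) : α • x ≠ β • y := by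
  rcases zmod3_cases α with r | r | r <;> rcases zmod3_cases β with s | s | s <;>
    first
    | exact absurd r hα
    | exact absurd s hβ
    | (subst r; subst s; simp only [one_smul, neg_smul, ne_eq, neg_inj]
       first
       | exact h1
       | exact h2
       | (intro h; exact h2 (by rw [← h, neg_neg])))

theorem SymCap.two {S : Finset V4} (h : SymCap S) {x y : V4} (hx : x ∈ S) (hy : y ∈ S)
    (h1 : x ≠ y) (h2 : x ≠ -y) {α β : ZMod 3} (e : α • x + β • y = 0) : α = 0 ∧ β = 0 := by
  have zx : x ≠ 0 := fun q => h.zero (q ▸ hx)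
  have zy : y ≠ 0 := fun q => h.zero (q ▸ hy)
  by_cases hα : α = 0
  · subst hα
    simpa [zy] using e
  · by_cases hβ : β = 0
    · subst hβ
      simpa [zx] using e
    · exfalso
      have hb : -β ≠ 0 := neg_ne_zero.mpr hβ
      apply smul_ne_smul_of h1 h2 hα hb
      rw [neg_smul]
      exact eq_neg_of_add_eq_zero_left e

theorem SymCap.dep {S : Finset V4} (h : SymCap S) {x y z : V4} (hx : x ∈ S) (hy : y ∈ S)
    (hz : z ∈ S) (xy : x ≠ y) (xy' : x ≠ -y) (xz : x ≠ z) (xz' : x ≠ -z) (yz : y ≠ z)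
    (yz' : y ≠ -z) {α β γ : ZMod 3} (e : α • x + β • y + γ • z = 0) :
    α = 0 ∧ β = 0 ∧ γ = 0 := by
  by_cases hα : α = 0
  · subst hα
    have := h.two hy hz yz yz' (α := β) (β := γ) (by simpa using e)
    exact ⟨rfl, this⟩
  by_cases hβ : β = 0
  · subst hβ
    have := h.two hx hz xz xz' (α := α) (β := γ) (by simpa using e)
    exact ⟨this.1, rfl, this.2⟩
  by_cases hγ : γ = 0
  · subst hγ
    have := h.two hx hy xy xy' (α := α) (β := β) (by simpa using e)
    exact ⟨this.1, this.2, rfl⟩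
  exact absurd e (h.cap _ (h.smul hx hα) _ (h.smul hy hβ) _ (h.smul hz hγ)
    (smul_ne_smul_of xy xy' hα hβ) (smul_ne_smul_of xz xz' hα hγ) (smul_ne_smul_of yz yz' hβ hγ))

theorem ker_finrank (f : V4 →ₗ[ZMod 3] ZMod 3) (hf : f ≠ 0) :
    Module.finrank (ZMod 3) (LinearMap.ker f) = 3 := by
  have h1 := LinearMap.finrank_range_add_finrank_ker f
  have h2 : LinearMap.range f = ⊤ := LinearMap.range_eq_top.mpr (LinearMap.surjective hf)
  rw [h2, finrank_top] at h1
  simp at h1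
  omega

theorem SymCap.comb {S : Finset V4} (h : SymCap S) {x y z : V4} (hx : x ∈ S) (hy : y ∈ S)
    (hz : z ∈ S) (xy : x ≠ y) (xy' : x ≠ -y) (xz : x ≠ z) (xz' : x ≠ -z) (yz : y ≠ z)
    (yz' : y ≠ -z) (f : V4 →ₗ[ZMod 3] ZMod 3) (hf : f ≠ 0) (fx : f x = 0) (fy : f y = 0)
    (fz : f z = 0) (p : V4) (fp : f p = 0) :
    ∃ α β γ : ZMod 3, p = α • x + β • y + γ • z := by
  let T : (ZMod 3 × ZMod 3 × ZMod 3) →ₗ[ZMod 3] LinearMap.ker f :=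
    { toFun := fun c => ⟨c.1 • x + c.2.1 • y + c.2.2 • z, by simp [fx, fy, fz]⟩
      map_add' := by intro a b; ext1; simp only [Prod.fst_add, Prod.snd_add, add_smul, Submodule.coe_add]; abel
      map_smul' := by intro a b; ext1; simp [smul_add, mul_smul] }
  have inj : Function.Injective T := by
    rw [injective_iff_map_eq_zero]
    rintro ⟨α, β, γ⟩ e
    have e' : α • x + β • y + γ • z = 0 := congrArg Subtype.val e
    obtain ⟨r, s, t⟩ := h.dep hx hy hz xy xy' xz xz' yz yz' e'
    simp [r, s, t]
  have sur : Function.Surjective T :=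
    (LinearMap.injective_iff_surjective_of_finrank_eq_finrank
      (by rw [ker_finrank f hf]; simp)).mp inj
  obtain ⟨⟨α, β, γ⟩, e⟩ := sur ⟨p, fp⟩
  exact ⟨α, β, γ, (congrArg Subtype.val e).symm⟩

theorem sign_pigeon : ∀ a b c a' b' c' : ZMod 3, a ≠ 0 → b ≠ 0 → c ≠ 0 → a' ≠ 0 → b' ≠ 0 →
    c' ≠ 0 → ∃ r : ZMod 3, (a' = r * a ∧ b' = r * b) ∨ (a' = r * a ∧ c' = r * c) ∨
      (b' = r * b ∧ c' = r * c) := by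
  have key : ∀ a a' : ZMod 3, a ≠ 0 → a' ≠ 0 → a' = 1 * a ∨ a' = -1 * a := by decide
  intro a b c a' b' c' ha hb hc ha' hb' hc'
  rcases key a a' ha ha' with h1 | h1 <;> rcases key b b' hb hb' with h2 | h2 <;>
    rcases key c c' hc hc' with h3 | h3 <;>
    first
    | exact ⟨_, Or.inl ⟨h1, h2⟩⟩
    | exact ⟨_, Or.inr (Or.inl ⟨h1, h3⟩)⟩
    | exact ⟨_, Or.inr (Or.inr ⟨h2, h3⟩)⟩

theorem exists_new (A B : Finset V4) (h : B.card < A.card) : ∃ x ∈ A, x ∉ B :=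
  Finset.exists_mem_notMem_of_card_lt_card h

theorem SymCap.nonzero {S : Finset V4} (h : SymCap S) {x y z p : V4} (hx : x ∈ S) (hy : y ∈ S)
    (hp : p ∈ S) (xy : x ≠ y) (xy' : x ≠ -y) (px : p ≠ x) (px' : p ≠ -x) (py : p ≠ y)
    (py' : p ≠ -y) {α β γ : ZMod 3} (e : p = α • x + β • y + γ • z) : γ ≠ 0 := by
  rintro rfl
  have := h.dep hp hx hy px px' py py' xy xy' (α := 1) (β := -α) (γ := -β)
    (by rw [e]; simp only [one_smul, neg_smul, zero_smul]; abel)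
  exact one_ne_zero this.1

theorem SymCap.le_eight {S : Finset V4} (h : SymCap S) (f : V4 →ₗ[ZMod 3] ZMod 3) (hf : f ≠ 0) :
    (S.filter fun x => f x = 0).card ≤ 8 := by
  by_contra! hc
  have c2 (u : V4) : ({u, -u} : Finset V4).card ≤ 2 := Finset.card_le_two
  obtain ⟨u, hu, -⟩ := exists_new _ (∅ : Finset V4) (lt_of_le_of_lt (by simp) hc)
  obtain ⟨v, hv, nv⟩ := exists_new _ ({u, -u} : Finset V4) (lt_of_le_of_lt ((c2 u).trans (by simp)) hc)
  obtain ⟨w, hw, nw⟩ := exists_new _ ({u, -u} ∪ {v, -v} : Finset V4) (lt_of_le_of_lt (by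
    have := Finset.card_union_le {u, -u} {v, -v}
    have := c2 u; have := c2 v; omega) hc)
  obtain ⟨p, hp, np⟩ := exists_new _ ({u, -u} ∪ {v, -v} ∪ {w, -w} : Finset V4) (lt_of_le_of_lt (by
    have := Finset.card_union_le {u, -u} {v, -v}
    have := Finset.card_union_le ({u, -u} ∪ {v, -v}) {w, -w}
    have := c2 u; have := c2 v; have := c2 w; omega) hc)
  obtain ⟨q, hq, nq⟩ := exists_new _ ({u, -u} ∪ {v, -v} ∪ {w, -w} ∪ {p, -p} : Finset V4)
    (lt_of_le_of_lt (by
    have := Finset.card_union_le {u, -u} {v, -v}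
    have := Finset.card_union_le ({u, -u} ∪ {v, -v}) {w, -w}
    have := Finset.card_union_le ({u, -u} ∪ {v, -v} ∪ {w, -w}) {p, -p}
    have := c2 u; have := c2 v; have := c2 w; have := c2 p; omega) hc)
  simp only [Finset.mem_filter, Finset.mem_union, Finset.mem_insert, Finset.mem_singleton,
    not_or] at hu hv nv hw nw hp np hq nq
  obtain ⟨vu, vu'⟩ := nv
  obtain ⟨⟨wu, wu'⟩, wv, wv'⟩ := nw
  obtain ⟨⟨⟨pu, pu'⟩, pv, pv'⟩, pw, pw'⟩ := np
  obtain ⟨⟨⟨⟨qu, qu'⟩, qv, qv'⟩, qw, qw'⟩, qp, qp'⟩ := nq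
  obtain ⟨hu, fu⟩ := hu
  obtain ⟨hv, fv⟩ := hv
  obtain ⟨hw, fw⟩ := hw
  obtain ⟨hp, fp⟩ := hp
  obtain ⟨hq, fq⟩ := hq
  obtain ⟨a, b, c, ep⟩ := h.comb hw hv hu wv wv' wu wu' vu vu' f hf fw fv fu p fp
  obtain ⟨a', b', c', eq⟩ := h.comb hw hv hu wv wv' wu wu' vu vu' f hf fw fv fu q fq
  have hc0 := h.nonzero hw hv hp wv wv' pw pw' pv pv' ep
  have hb0 := h.nonzero hw hu hp wu wu' pw pw' pu pu' (α := a) (β := c) (z := v) (γ := b)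
    (by rw [ep]; abel)
  have ha0 := h.nonzero hv hu hp vu vu' pv pv' pu pu' (α := b) (β := c) (z := w) (γ := a)
    (by rw [ep]; abel)
  have hc1 := h.nonzero hw hv hq wv wv' qw qw' qv qv' eq
  have hb1 := h.nonzero hw hu hq wu wu' qw qw' qu qu' (α := a') (β := c') (z := v) (γ := b')
    (by rw [eq]; abel)
  have ha1 := h.nonzero hv hu hq vu vu' qv qv' qu qu' (α := b') (β := c') (z := w) (γ := a')
    (by rw [eq]; abel)
  obtain ⟨r, ⟨e1, e2⟩ | ⟨e1, e2⟩ | ⟨e1, e2⟩⟩ := sign_pigeon a b c a' b' c' ha0 hb0 hc0 ha1 hb1 hc1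
  · have := h.dep hq hp hu qp qp' qu qu' pu pu' (α := 1) (β := -r) (γ := r * c - c')
      (by rw [eq, ep, e1, e2]; module)
    exact one_ne_zero this.1
  · have := h.dep hq hp hv qp qp' qv qv' pv pv' (α := 1) (β := -r) (γ := r * b - b')
      (by rw [eq, ep, e1, e2]; module)
    exact one_ne_zero this.1
  · have := h.dep hq hp hw qp qp' qw qw' pw pw' (α := 1) (β := -r) (γ := r * a - a')
      (by rw [eq, ep, e1, e2]; module)
    exact one_ne_zero this.1

theorem exists_indep (f : V4 →ₗ[ZMod 3] ZMod 3) (u v : V4) :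
    ∃ g : V4 →ₗ[ZMod 3] ZMod 3, g u = 0 ∧ g v = 0 ∧ ∀ c : ZMod 3, g ≠ c • f := by
  let W : Submodule (ZMod 3) V4 := Submodule.span (ZMod 3) ({u, v} : Set V4)
  have hW : Module.finrank (ZMod 3) W ≤ 2 := by
    have := finrank_span_finset_le_card (R := ZMod 3) ({u, v} : Finset V4)
    have h2 : ({u, v} : Finset V4).card ≤ 2 := Finset.card_le_two
    simp only [Finset.coe_insert, Finset.coe_singleton] at this
    exact this.trans h2
  have hA := Subspace.finrank_add_finrank_dualAnnihilator_eq W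
  have h4 : Module.finrank (ZMod 3) V4 = 4 := by simp
  by_contra! hcon
  have hle : W.dualAnnihilator ≤ Submodule.span (ZMod 3) ({f} : Set (Module.Dual (ZMod 3) V4)) := by
    intro g hg
    rw [Submodule.mem_dualAnnihilator] at hg
    obtain ⟨c, hc⟩ := hcon g (hg u (Submodule.subset_span (by simp)))
      (hg v (Submodule.subset_span (by simp)))
    exact Submodule.mem_span_singleton.mpr ⟨c, hc.symm⟩
  have h5 := Submodule.finrank_mono hle
  have h6 := finrank_span_le_card (R := ZMod 3) ({f} : Set (Module.Dual (ZMod 3) V4))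
  simp only [Set.toFinset_singleton, Finset.card_singleton] at h6
  omega

theorem pencil_pt : ∀ s t : ZMod 3, (if s = 0 then 1 else 0) + (if t = 0 then 1 else 0) +
    (if t + s = 0 then 1 else 0) + (if t - s = 0 then 1 else 0) =
    1 + 3 * (if s = 0 ∧ t = 0 then 1 else 0 : ℕ) := by decide

theorem pencil (S : Finset V4) (f g : V4 →ₗ[ZMod 3] ZMod 3) :
    (S.filter fun x => f x = 0).card + (S.filter fun x => g x = 0).card +
    (S.filter fun x => (g + f) x = 0).card + (S.filter fun x => (g - f) x = 0).card =
    S.card + 3 * (S.filter fun x => f x = 0 ∧ g x = 0).card := by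
  simp only [Finset.card_filter, Finset.card_eq_sum_ones S, Finset.mul_sum,
    ← Finset.sum_add_distrib]
  apply Finset.sum_congr rfl
  intro x _
  simpa using pencil_pt (f x) (g x)

theorem indep_ne {f g : V4 →ₗ[ZMod 3] ZMod 3} (hg : ∀ c : ZMod 3, g ≠ c • f) :
    g ≠ 0 ∧ g + f ≠ 0 ∧ g - f ≠ 0 := by
  refine ⟨fun e => hg 0 (by simpa using e), fun e => hg (-1) ?_, fun e => hg 1 ?_⟩
  · rw [eq_neg_of_add_eq_zero_left e]
    apply LinearMap.ext
    intro x
    simp only [LinearMap.neg_apply, LinearMap.smul_apply, smul_eq_mul, neg_mul, one_mul]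
  · rw [one_smul]; exact sub_eq_zero.mp e

theorem SymCap.weak {S : Finset V4} (h : SymCap S) (h20 : S.card = 20)
    (f : V4 →ₗ[ZMod 3] ZMod 3) (hf : f ≠ 0) :
    (S.filter fun x => f x = 0).card = 0 ∨ (S.filter fun x => f x = 0).card = 2 ∨
    (S.filter fun x => f x = 0).card = 8 := by
  by_cases h0 : (S.filter fun x => f x = 0).card = 0
  · exact Or.inl h0
  right
  obtain ⟨u, hu⟩ := Finset.card_pos.mp (Nat.pos_of_ne_zero h0)
  rw [Finset.mem_filter] at hu
  have zu : u ≠ 0 := fun q => h.zero (q ▸ hu.1)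
  have pu : ({u, -u} : Finset V4).card = 2 := Finset.card_pair (v4_ne_neg zu)
  by_cases h2 : (S.filter fun x => f x = 0).card ≤ 2
  · left
    have : ({u, -u} : Finset V4) ⊆ S.filter fun x => f x = 0 := by
      intro y hy
      simp only [Finset.mem_insert, Finset.mem_singleton] at hy
      rcases hy with rfl | rfl
      · simp [hu]
      · simp [hu, h.neg u hu.1]
    have := Finset.card_le_card this
    omega
  right
  obtain ⟨v, hv, nv⟩ := exists_new (S.filter fun x => f x = 0) ({u, -u} : Finset V4) (by omega)
  simp only [Finset.mem_filter, Finset.mem_insert, Finset.mem_singleton, not_or] at hv nv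
  have zv : v ≠ 0 := fun q => h.zero (q ▸ hv.1)
  have pv : ({v, -v} : Finset V4).card = 2 := Finset.card_pair (v4_ne_neg zv)
  obtain ⟨g, gu, gv, hg⟩ := exists_indep f u v
  obtain ⟨g1, g2, g3⟩ := indep_ne hg
  have hp := pencil S f g
  have k : ({u, -u} ∪ {v, -v} : Finset V4) ⊆ S.filter fun x => f x = 0 ∧ g x = 0 := by
    intro y hy
    simp only [Finset.mem_union, Finset.mem_insert, Finset.mem_singleton] at hy
    rcases hy with (rfl | rfl) | (rfl | rfl)
    · simp [hu, gu]
    · simp [hu, h.neg u hu.1, gu]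
    · simp [hv, gv]
    · simp [hv, h.neg v hv.1, gv]
  have k2 := Finset.card_le_card k
  rw [Finset.card_union_of_disjoint, pu, pv] at k2
  · have := h.le_eight f hf
    have := h.le_eight _ g1
    have := h.le_eight _ g2
    have := h.le_eight _ g3
    omega
  · rw [Finset.disjoint_left]
    intro y hy hy'
    simp only [Finset.mem_insert, Finset.mem_singleton] at hy hy'
    rcases hy with rfl | rfl <;> rcases hy' with e | e
    · exact nv.1 e.symm
    · exact nv.2 (by rw [e, neg_neg])
    · exact nv.2 e.symm
    · exact nv.1 (neg_injective e).symm

theorem SymCap.strong {S : Finset V4} (h : SymCap S) (h20 : S.card = 20)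
    (f : V4 →ₗ[ZMod 3] ZMod 3) (hf : f ≠ 0) :
    (S.filter fun x => f x = 0).card = 2 ∨ (S.filter fun x => f x = 0).card = 8 := by
  rcases h.weak h20 f hf with h0 | h0
  · exfalso
    obtain ⟨g, -, -, hg⟩ := exists_indep f 0 0
    obtain ⟨g1, g2, g3⟩ := indep_ne hg
    have hp := pencil S f g
    have k : (S.filter fun x => f x = 0 ∧ g x = 0).card ≤ (S.filter fun x => f x = 0).card :=
      Finset.card_le_card (fun y hy => by
        simp only [Finset.mem_filter] at hy ⊢
        exact ⟨hy.1, hy.2.1⟩)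
    have := h.weak h20 _ g1
    have := h.weak h20 _ g2
    have := h.weak h20 _ g3
    omega
  · exact h0


/-- For a 20-point cap `C` with anchor `a` and the three parallel hyperplanes given by
a nonzero linear functional `f`, with `a` in the hyperplane `f = f a`: the two
hyperplanes not containing `a` meet `C` in equally many points, and the hyperplane
through `a` meets `C` in 2 or 8 points. -/
theorem cap_hyperplane_distribution (C : Finset V4) (a : V4) (d d' : Fin 10 → V4)
    (hpair : ∀ i, a + d i + d' i = 0)
    (hC : C = Finset.univ.image d ∪ Finset.univ.image d')
    (hcard : C.card = 20) (hcap : IsCap (↑C : Set V4)) (ha : a ∉ C)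
    (f : V4 →ₗ[ZMod 3] ZMod 3) (hf : f ≠ 0) :
    (C.filter fun x => f x = f a + 1).card = (C.filter fun x => f x = f a + 2).card ∧
    ((C.filter fun x => f x = f a).card = 2 ∨ (C.filter fun x => f x = f a).card = 8) := by
  have refl_mem : ∀ x ∈ C, -a - x ∈ C := by
    intro x hx
    rw [hC] at hx ⊢
    simp only [Finset.mem_union, Finset.mem_image, Finset.mem_univ, true_and] at hx ⊢
    rcases hx with ⟨i, rfl⟩ | ⟨i, rfl⟩
    · right
      exact ⟨i, by rw [eq_neg_of_add_eq_zero_right (hpair i)]; abel⟩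
    · left
      refine ⟨i, ?_⟩
      have := hpair i
      have e : d i = (a + d i + d' i) - a - d' i := by abel
      rw [e, this]; abel
  have a3 := three_v4 a
  have inj : Function.Injective (fun x : V4 => x - a) := sub_left_injective
  have hS : SymCap (C.image fun x => x - a) := by
    refine ⟨?_, ?_, ?_⟩
    · intro y hy
      obtain ⟨x, hx, rfl⟩ := Finset.mem_image.mp hy
      refine Finset.mem_image.mpr ⟨_, refl_mem x hx, ?_⟩
      have : -a - x - a = -(x - a) - (a + a + a) := by abel
      rw [this, a3, sub_zero]
    · intro h0
      obtain ⟨x, hx, e⟩ := Finset.mem_image.mp h0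
      exact ha (sub_eq_zero.mp e ▸ hx)
    · intro x hx y hy z hz xy xz yz e
      obtain ⟨x, mx, rfl⟩ := Finset.mem_image.mp hx
      obtain ⟨y, my, rfl⟩ := Finset.mem_image.mp hy
      obtain ⟨z, mz, rfl⟩ := Finset.mem_image.mp hz
      refine hcap x mx y my z mz (fun q => xy (by rw [q])) (fun q => xz (by rw [q]))
        (fun q => yz (by rw [q])) ?_
      have : x + y + z = (x - a + (y - a) + (z - a)) + (a + a + a) := by abel
      rw [this, e, a3, add_zero]
  have h20 : (C.image fun x => x - a).card = 20 := by
    rw [Finset.card_image_of_injective _ inj, hcard]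
  have key := hS.strong h20 f hf
  rw [Finset.filter_image, Finset.card_image_of_injective _ inj] at key
  simp only [map_sub, sub_eq_zero] at key
  have z1 : ∀ s t : ZMod 3, t = s + 1 → -s - t = s + 2 := by decide
  have z2 : ∀ s t : ZMod 3, t = s + 2 → -s - t = s + 1 := by decide
  refine ⟨?_, key⟩
  refine Finset.card_bij' (fun x _ => -a - x) (fun x _ => -a - x) ?_ ?_ ?_ ?_
  · intro x hx
    rw [Finset.mem_filter] at hx ⊢
    exact ⟨refl_mem x hx.1, by rw [map_sub, map_neg]; exact z1 _ _ hx.2⟩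
  · intro x hx
    rw [Finset.mem_filter] at hx ⊢
    exact ⟨refl_mem x hx.1, by rw [map_sub, map_neg]; exact z2 _ _ hx.2⟩
  · intro x _; abel
  · intro x _; abel
end
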